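/- Let (X_n)_{n≥1} be stationary and ergodic with X_1 ~ P. The limit lim_{n→∞} L_n(X_1^n, Q^n, D) fails to exist with positive probability if and only if all of the following hold: 0 < D = D_min(P,Q) < ∞, R(P,Q,D) < ∞, and ρ_Q(X_1) is not almost surely constant. -/

import Mathlib

open MeasureTheory Filter Set Topology Classical
open scoped ENNReal NNReal

noncomputable section

/-- `-log t` as a value in `ℝ≥0∞` (equal to `∞` when `t = 0`); intended for `t ≤ 1`. -/
def negLog (t : ℝ≥0∞) : ℝ≥0∞ :=
  if t = 0 then ∞ else ENNReal.ofReal (-Real.log t.toReal)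

/-- `log t` as a value in `ℝ≥0∞` (equal to `∞` when `t = ∞`); intended for `t ≥ 1`. -/
def posLog (t : ℝ≥0∞) : ℝ≥0∞ :=
  if t = ∞ then ∞ else ENNReal.ofReal (Real.log t.toReal)

/-- The extended-real-valued logarithm of an `ℝ≥0∞` number. -/
def eLog (t : ℝ≥0∞) : EReal :=
  if t = 0 then ⊥ else if t = ∞ then ⊤ else ((Real.log t.toReal : ℝ) : EReal)

/-- Relative entropy `H(μ‖ν)` (in nats), valued in `ℝ≥0∞`: it equals
`∫ log (dμ/dν) dμ` when `μ ≪ ν` (and `+∞` when this integral is not defined,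
which for probability measures can only mean `+∞`), and `+∞` when `¬ μ ≪ ν`. -/
def relEnt {α : Type*} [MeasurableSpace α] (μ ν : Measure α) : ℝ≥0∞ :=
  if μ ≪ ν ∧ Integrable (llr μ ν) μ then ENNReal.ofReal (∫ x, llr μ ν x ∂μ) else ∞

/-- The set `W(P,D)` of couplings: probability measures on `S × T` with first
marginal `P` and expected distortion at most `D`. -/
def distSet {S T : Type*} [MeasurableSpace S] [MeasurableSpace T]
    (ρ : S × T → ℝ) (P : Measure S) (D : ℝ) : Set (Measure (S × T)) :=
  {W | IsProbabilityMeasure W ∧ W.map Prod.fst = P ∧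
    ((∫⁻ z, ENNReal.ofReal (ρ z) ∂W : ℝ≥0∞) : EReal) ≤ ((D : ℝ) : EReal)}

/-- The rate function `R(P,Q,D) = inf_{W ∈ W(P,D)} H(W‖P×Q)` (equal to `+∞`
when `W(P,D)` is empty). -/
def Rrate {S T : Type*} [MeasurableSpace S] [MeasurableSpace T]
    (ρ : S × T → ℝ) (P : Measure S) (Q : Measure T) (D : ℝ) : ℝ≥0∞ :=
  ⨅ W ∈ distSet ρ P D, relEnt W (P.prod Q)

/-- `Λ(P,Q,λ) = E_X[log E_Y e^{λρ(X,Y)}]`, valued in `EReal`.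
For `λ ≥ 0` the integrand lies in `[0,∞]`; for `λ < 0` it lies in `[-∞,0]`. -/
def Lam {S T : Type*} [MeasurableSpace S] [MeasurableSpace T]
    (ρ : S × T → ℝ) (P : Measure S) (Q : Measure T) (l : ℝ) : EReal :=
  if 0 ≤ l then
    ((∫⁻ x, posLog (∫⁻ y, ENNReal.ofReal (Real.exp (l * ρ (x, y))) ∂Q) ∂P : ℝ≥0∞) : EReal)
  else
    -(((∫⁻ x, negLog (∫⁻ y, ENNReal.ofReal (Real.exp (l * ρ (x, y))) ∂Q) ∂P : ℝ≥0∞) : EReal))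

/-- The Fenchel–Legendre transform `Λ*(P,Q,D) = sup_{λ ≤ 0} [λD - Λ(P,Q,λ)]`. -/
def LamStar {S T : Type*} [MeasurableSpace S] [MeasurableSpace T]
    (ρ : S × T → ℝ) (P : Measure S) (Q : Measure T) (D : ℝ) : EReal :=
  ⨆ l ∈ Iic (0 : ℝ), (((l * D : ℝ) : EReal) - Lam ρ P Q l)

/-- `ρ_Q(x) := essinf_{Y ∼ Q} ρ(x,Y)`. -/
def rhoQ {S T : Type*} [MeasurableSpace T]
    (ρ : S × T → ℝ) (Q : Measure T) (x : S) : ℝ :=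
  essInf (fun y => ρ (x, y)) Q

/-- `D_min(P,Q) := inf {D : Λ*(P,Q,D) < ∞}`. -/
def DminPQ {S T : Type*} [MeasurableSpace S] [MeasurableSpace T]
    (ρ : S × T → ℝ) (P : Measure S) (Q : Measure T) : ℝ :=
  sInf {D : ℝ | LamStar ρ P Q D ≠ ⊤}

/-- `D_ave(P,Q) := E ρ(X,Y)` for independent `X ∼ P`, `Y ∼ Q`, valued in `ℝ≥0∞`. -/
def DavePQ {S T : Type*} [MeasurableSpace S] [MeasurableSpace T]
    (ρ : S × T → ℝ) (P : Measure S) (Q : Measure T) : ℝ≥0∞ :=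
  ∫⁻ z, ENNReal.ofReal (ρ z) ∂(P.prod Q)

/-- The candidate derivative `Λ'(λ)` of `Λ(P,Q,·)`. -/
def LamD {S T : Type*} [MeasurableSpace S] [MeasurableSpace T]
    (ρ : S × T → ℝ) (P : Measure S) (Q : Measure T) (l : ℝ) : ℝ :=
  ∫ x, (∫ y, ρ (x, y) * Real.exp (l * ρ (x, y)) ∂Q) /
    (∫ y, Real.exp (l * ρ (x, y)) ∂Q) ∂P

/-- The left shift on sequences. -/
def shiftSeq {α : Type*} (x : ℕ → α) (n : ℕ) : α := x (n + 1)

/-- The single-letter distortion measure `ρ_n` on `n`-strings. -/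
def rhoFin {S T : Type*} (ρ : S × T → ℝ) (n : ℕ) (x : Fin n → S) (y : Fin n → T) : ℝ :=
  (n : ℝ)⁻¹ * ∑ k, ρ (x k, y k)

/-- `L_n(x_1^n, Q^n, D) = -(1/n) log Q^n(B_n(x_1^n,D))`, valued in `ℝ≥0∞`,
for a memoryless (product) codebook distribution `Q^n`. -/
def LnIID {S T : Type*} [MeasurableSpace T]
    (ρ : S × T → ℝ) (Q : Measure T) (D : ℝ) (n : ℕ) (x : ℕ → S) : ℝ≥0∞ :=
  (n : ℝ≥0∞)⁻¹ *
    negLog ((Measure.pi fun _ : Fin n => Q) {y | rhoFin ρ n (fun k => x k) y ≤ D})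

/-- The empirical distribution `P_{x_1^n} = (1/n) ∑_{k=1}^n δ_{x_k}`. -/
def empMeas {S : Type*} [MeasurableSpace S] (n : ℕ) (x : ℕ → S) : Measure S :=
  (n : ℝ≥0∞)⁻¹ • ∑ k ∈ Finset.range n, Measure.dirac (x k)

/-- The `n`-dimensional marginal of a measure on sequences. -/
def margN {α : Type*} [MeasurableSpace α] (μ : Measure (ℕ → α)) (n : ℕ) :
    Measure (Fin n → α) :=
  μ.map fun x (k : Fin n) => x (k : ℕ)

/-- The strong mixing condition `C⁻¹ 𝒬(A) 𝒬(B) ≤ 𝒬(A ∩ B) ≤ C 𝒬(A) 𝒬(B)` for all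
`A ∈ σ(Y_1^n)`, `B ∈ σ(Y_{n+1}^∞)` and all `n`. -/
def Mixing {T : Type*} [MeasurableSpace T] (𝒬 : Measure (ℕ → T)) (C : ℝ) : Prop :=
  ∀ (n : ℕ) (A B : Set (ℕ → T)),
    MeasurableSet[MeasurableSpace.comap (fun y (k : Fin n) => y (k : ℕ)) inferInstance] A →
    MeasurableSet[MeasurableSpace.comap (fun y (k : ℕ) => y (k + n)) inferInstance] B →
    (ENNReal.ofReal C)⁻¹ * (𝒬 A * 𝒬 B) ≤ 𝒬 (A ∩ B) ∧
      𝒬 (A ∩ B) ≤ ENNReal.ofReal C * (𝒬 A * 𝒬 B)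

/-- `L_n(x_1^n, Q_n, D) = -(1/n) log Q_n(B_n(x_1^n,D))` where `Q_n` is the
`n`-dimensional marginal of the codebook process law `𝒬`. -/
def LnMem {S T : Type*} [MeasurableSpace T]
    (ρ : S × T → ℝ) (𝒬 : Measure (ℕ → T)) (D : ℝ) (n : ℕ) (x : ℕ → S) : ℝ≥0∞ :=
  (n : ℝ≥0∞)⁻¹ * negLog (margN 𝒬 n {y | rhoFin ρ n (fun k => x k) y ≤ D})

/-- The set `W_n(P_n,D)` of couplings on `S^n × T^n`. -/
def distSetN {S T : Type*} [MeasurableSpace S] [MeasurableSpace T]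
    (ρ : S × T → ℝ) (n : ℕ) (Pn : Measure (Fin n → S)) (D : ℝ) :
    Set (Measure ((Fin n → S) × (Fin n → T))) :=
  {W | IsProbabilityMeasure W ∧ W.map Prod.fst = Pn ∧
    ((∫⁻ z, ENNReal.ofReal (rhoFin ρ n z.1 z.2) ∂W : ℝ≥0∞) : EReal) ≤ ((D : ℝ) : EReal)}

/-- `R_n(P_n,Q_n,D) = (1/n) inf_{W_n ∈ W_n(P_n,D)} H(W_n‖P_n×Q_n)`. -/
def RnMem {S T : Type*} [MeasurableSpace S] [MeasurableSpace T]
    (ρ : S × T → ℝ) (n : ℕ) (Pn : Measure (Fin n → S)) (Qn : Measure (Fin n → T))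
    (D : ℝ) : ℝ≥0∞ :=
  (n : ℝ≥0∞)⁻¹ * ⨅ W ∈ distSetN ρ n Pn D, relEnt W (Pn.prod Qn)

/-- `Λ_n(P_n,Q_n,λ) = E_{X_1^n}[log E_{Y_1^n} e^{λ ρ_n(X_1^n,Y_1^n)}]`. -/
def LamN {S T : Type*} [MeasurableSpace S] [MeasurableSpace T]
    (ρ : S × T → ℝ) (n : ℕ) (Pn : Measure (Fin n → S)) (Qn : Measure (Fin n → T))
    (l : ℝ) : EReal :=
  Lam (fun z => rhoFin ρ n z.1 z.2) Pn Qn l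

/-- `Λ_n*(P_n,Q_n,D) = (1/n) sup_{λ ≤ 0} [λD - Λ_n(P_n,Q_n,λ)]`. -/
def LamStarN {S T : Type*} [MeasurableSpace S] [MeasurableSpace T]
    (ρ : S × T → ℝ) (n : ℕ) (Pn : Measure (Fin n → S)) (Qn : Measure (Fin n → T))
    (D : ℝ) : EReal :=
  (((n : ℝ)⁻¹ : ℝ) : EReal) *
    ⨆ l ∈ Iic (0 : ℝ), (((l * D : ℝ) : EReal) - LamN ρ n Pn Qn l)

/-- One-sided Fenchel–Legendre transform `D ↦ sup_{λ ≤ 0} [λD - Λ(λ)]` of a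
function `Λ : ℝ → EReal`. -/
def FLT (L : ℝ → EReal) (D : ℝ) : EReal :=
  ⨆ l ∈ Iic (0 : ℝ), (((l * D : ℝ) : EReal) - L l)

set_option linter.unusedSectionVars false
set_option linter.unusedVariables false

namespace GAEP

section Erg
variable {Ω : Type*} [MeasurableSpace Ω] {μ : Measure Ω} [IsProbabilityMeasure μ] {θ : Ω → Ω}

/-- Partial ergodic sums. -/
def bs (θ : Ω → Ω) (f : Ω → ℝ) (n : ℕ) (x : Ω) : ℝ := ∑ k ∈ Finset.range n, f (θ^[k] x)

lemma bs_succ (f : Ω → ℝ) (n : ℕ) (x : Ω) : bs θ f (n+1) x = f x + bs θ f n (θ x) := by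
  unfold bs
  rw [Finset.sum_range_succ']
  simp [Function.iterate_succ_apply, add_comm]

lemma bs_meas (hθ : Measurable θ) {f : Ω → ℝ} (hf : Measurable f) (n : ℕ) :
    Measurable (bs θ f n) := by
  unfold bs
  exact Finset.measurable_sum _ fun k _ => hf.comp (hθ.iterate k)

/-- running minimum of the ergodic sums -/
def rmin (θ : Ω → Ω) (f : Ω → ℝ) : ℕ → Ω → ℝ
  | 0 => fun _ => 0
  | n+1 => fun x => min 0 (f x + rmin θ f n (θ x))

lemma rmin_succ (f : Ω → ℝ) (n : ℕ) (x : Ω) :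
    rmin θ f (n+1) x = min 0 (f x + rmin θ f n (θ x)) := rfl

lemma rmin_nonpos (f : Ω → ℝ) (n : ℕ) (x : Ω) : rmin θ f n x ≤ 0 := by
  cases n <;> simp [rmin]

lemma rmin_anti (f : Ω → ℝ) (n : ℕ) (x : Ω) : rmin θ f (n+1) x ≤ rmin θ f n x := by
  induction n generalizing x with
  | zero => simp [rmin]
  | succ n ih =>
    rw [rmin_succ f (n+1) x, rmin_succ f n x]
    exact min_le_min_left _ (by linarith [ih (θ x)])

lemma rmin_le (f : Ω → ℝ) (n : ℕ) (x : Ω) : rmin θ f n x ≤ bs θ f n x := by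
  induction n generalizing x with
  | zero => simp [rmin, bs]
  | succ n ih =>
    rw [rmin_succ, bs_succ]
    exact (min_le_right _ _).trans (by linarith [ih (θ x)])

lemma rmin_anti' (f : Ω → ℝ) (x : Ω) : Antitone fun n => rmin θ f n x :=
  antitone_nat_of_succ_le fun n => rmin_anti f n x

lemma exists_bs_eq_rmin (f : Ω → ℝ) (n : ℕ) (x : Ω) : ∃ k, rmin θ f n x = bs θ f k x := by
  induction n generalizing x with
  | zero => exact ⟨0, by simp [rmin, bs]⟩
  | succ n ih =>
    rw [rmin_succ]
    rcases min_choice 0 (f x + rmin θ f n (θ x)) with h | h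
    · exact ⟨0, by rw [h]; simp [bs]⟩
    · obtain ⟨k, hk⟩ := ih (θ x)
      exact ⟨k+1, by rw [h, bs_succ, hk]⟩

lemma rmin_meas (hθ : Measurable θ) {f : Ω → ℝ} (hf : Measurable f) (n : ℕ) :
    Measurable (rmin θ f n) := by
  induction n with
  | zero => exact measurable_const
  | succ n ih => exact measurable_const.min (hf.add (ih.comp hθ))

lemma rmin_int (hθ : MeasurePreserving θ μ μ) {f : Ω → ℝ} (hf : Integrable f μ) (n : ℕ) :
    Integrable (rmin θ f n) μ := by
  induction n with
  | zero => exact integrable_zero _ _ _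
  | succ n ih =>
    have := (hf.add (hθ.integrable_comp_of_integrable ih))
    exact (integrable_zero Ω ℝ μ).inf this

lemma maximal (hθ : MeasurePreserving θ μ μ) {f : Ω → ℝ} (hm : Measurable f)
    (hf : Integrable f μ) (n : ℕ) :
    ∫ x in {x | rmin θ f (n+1) x < 0}, f x ∂μ ≤ 0 := by
  have hs : MeasurableSet {x | rmin θ f (n+1) x < 0} :=
    measurableSet_lt (rmin_meas hθ.measurable hm _) measurable_const
  rw [← integral_indicator hs]
  have hi := rmin_int hθ hf n
  have hi2 : Integrable (fun x => rmin θ f n (θ x)) μ := hθ.integrable_comp_of_integrable hi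
  have : ∫ x, (rmin θ f n x - rmin θ f n (θ x)) ∂μ = 0 := by
    rw [integral_sub hi hi2, sub_eq_zero]
    have h3 : ∫ x, rmin θ f n x ∂(μ.map θ) = ∫ x, rmin θ f n (θ x) ∂μ :=
      integral_map hθ.measurable.aemeasurable
        ((rmin_meas hθ.measurable hm n).aestronglyMeasurable)
    rw [← h3, hθ.map_eq]
  refine le_of_le_of_eq ?_ this
  refine integral_mono (hf.indicator hs) (hi.sub hi2) fun x => ?_
  by_cases hx : rmin θ f (n+1) x < 0
  · rw [indicator_of_mem (by exact hx)]
    have h1 := rmin_anti (θ := θ) f n x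
    have h2 : rmin θ f (n+1) x = f x + rmin θ f n (θ x) := by
      rw [rmin_succ] at hx ⊢
      rcases min_choice 0 (f x + rmin θ f n (θ x)) with h | h
      · rw [h] at hx; exact absurd hx (lt_irrefl _)
      · exact h
    linarith
  · rw [indicator_of_notMem (by exact hx)]
    have h1 := rmin_anti (θ := θ) f n x
    have h2 := rmin_nonpos (θ := θ) f n (θ x)
    push Not at hx
    show (0:ℝ) ≤ rmin θ f n x - rmin θ f n (θ x)
    linarith

/-- unbounded below set -/
lemma unbdd_inv (f : Ω → ℝ) :
    θ ⁻¹' {x | ∀ C : ℕ, ∃ n, bs θ f n x < -(C:ℝ)} = {x | ∀ C : ℕ, ∃ n, bs θ f n x < -(C:ℝ)} := by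
  ext x
  simp only [mem_preimage, mem_ofPred_eq]
  constructor
  · intro h C
    obtain ⟨C', hC'⟩ := exists_nat_ge ((C:ℝ) + f x)
    obtain ⟨n, hn⟩ := h C'
    exact ⟨n+1, by rw [bs_succ]; linarith⟩
  · intro h C
    obtain ⟨C', hC'⟩ := exists_nat_ge (max ((C:ℝ) - f x) 0)
    obtain ⟨n, hn⟩ := h C'
    have h1 := le_max_left ((C:ℝ) - f x) 0
    have h2 := le_max_right ((C:ℝ) - f x) 0
    cases n with
    | zero => simp [bs] at hn; linarith
    | succ n => rw [bs_succ] at hn; exact ⟨n, by linarith⟩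

lemma unbdd_meas (hθ : Measurable θ) {f : Ω → ℝ} (hf : Measurable f) :
    MeasurableSet {x | ∀ C : ℕ, ∃ n, bs θ f n x < -(C:ℝ)} := by
  have : {x | ∀ C : ℕ, ∃ n, bs θ f n x < -(C:ℝ)} = ⋂ C : ℕ, ⋃ n, {x | bs θ f n x < -(C:ℝ)} := by
    ext x; simp
  rw [this]
  exact MeasurableSet.iInter fun C => MeasurableSet.iUnion fun n =>
    measurableSet_lt (bs_meas hθ hf n) measurable_const

lemma bddBelow_of_pos (hE : Ergodic θ μ) {f : Ω → ℝ} (hm : Measurable f)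
    (hf : Integrable f μ) (hpos : 0 < ∫ x, f x ∂μ) :
    ∀ᵐ x ∂μ, ¬ ∀ C : ℕ, ∃ n, bs θ f n x < -(C:ℝ) := by
  rcases hE.toPreErgodic.ae_mem_or_ae_notMem (unbdd_meas hE.measurable hm) (unbdd_inv f) with h | h
  · exfalso
    have hmp := hE.toMeasurePreserving
    have hs : ∀ n, MeasurableSet {x | rmin θ f (n+1) x < 0} := fun n =>
      measurableSet_lt (rmin_meas hE.measurable hm _) measurable_const
    have ht : Tendsto (fun n => ∫ x, {x | rmin θ f (n+1) x < 0}.indicator f x ∂μ) atTop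
        (𝓝 (∫ x, f x ∂μ)) := by
      refine tendsto_integral_of_dominated_convergence (fun x => |f x|)
        (fun n => (hm.indicator (hs n)).aestronglyMeasurable) hf.abs
        (fun n => .of_forall fun x => ?_) ?_
      · rw [Real.norm_eq_abs]
        by_cases hx : x ∈ {x | rmin θ f (n+1) x < 0}
        · rw [indicator_of_mem hx]
        · rw [indicator_of_notMem hx]; simp
      · filter_upwards [h] with x hx
        obtain ⟨n, hn⟩ := hx 0
        refine tendsto_const_nhds.congr' ?_
        filter_upwards [eventually_ge_atTop n] with k hk
        rw [indicator_of_mem]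
        have := rmin_anti' (θ := θ) f x (show n ≤ k+1 by omega)
        have h2 := rmin_le (θ := θ) f n x
        simp only [Nat.cast_zero, neg_zero] at hn
        show rmin θ f (k+1) x < 0
        exact lt_of_le_of_lt (this.trans h2) hn
    have : ∫ x, f x ∂μ ≤ 0 := le_of_tendsto' ht fun n => by
      rw [integral_indicator (hs n)]; exact maximal hmp hm hf n
    linarith
  · exact h

lemma bs_sub_const (f : Ω → ℝ) (c : ℝ) (n : ℕ) (x : Ω) :
    bs θ (fun x => f x - c) n x = bs θ f n x - n * c := by
  simp [bs, Finset.sum_sub_distrib]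

lemma birk_lower (hE : Ergodic θ μ) {f : Ω → ℝ} (hm : Measurable f)
    (hf : Integrable f μ) (c : ℝ) (hc : c < ∫ x, f x ∂μ) :
    ∀ᵐ x ∂μ, ∀ᶠ n : ℕ in atTop, c < bs θ f n x / n := by
  obtain ⟨c', h1, h2⟩ := exists_between hc
  have := bddBelow_of_pos hE (f := fun x => f x - c') (hm.sub_const _)
    (hf.sub (integrable_const _)) (by
      rw [integral_sub hf (integrable_const _)]; simpa using h2)
  filter_upwards [this] with x hx
  push Not at hx
  obtain ⟨C, hC⟩ := hx
  obtain ⟨N, hN⟩ := exists_nat_gt ((C:ℝ) / (c' - c))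
  filter_upwards [eventually_ge_atTop (max N 1)] with n hn
  have hn0 : (0:ℝ) < n := by
    have : 1 ≤ n := (le_max_right _ _).trans hn
    exact_mod_cast this
  rw [lt_div_iff₀ hn0]
  have h3 := hC n
  rw [bs_sub_const] at h3
  have h4 : (N:ℝ) ≤ n := by exact_mod_cast (le_max_left _ _).trans hn
  have h5 : (C:ℝ) < n * (c' - c) := by
    rw [div_lt_iff₀ (by linarith)] at hN
    nlinarith
  linarith

lemma birkhoff (hE : Ergodic θ μ) {f : Ω → ℝ} (hm : Measurable f) (hf : Integrable f μ) :
    ∀ᵐ x ∂μ, Tendsto (fun n : ℕ => bs θ f n x / n) atTop (𝓝 (∫ x, f x ∂μ)) := by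
  have h1 : ∀ k : ℕ, ∀ᵐ x ∂μ, ∀ᶠ n : ℕ in atTop, (∫ x, f x ∂μ) - 1/((k:ℝ)+1) < bs θ f n x / n :=
    fun k => birk_lower hE hm hf _ (by have : (0:ℝ) < 1/((k:ℝ)+1) := by positivity
                                       linarith)
  have h2 : ∀ k : ℕ, ∀ᵐ x ∂μ, ∀ᶠ n : ℕ in atTop,
      (∫ x, -f x ∂μ) - 1/((k:ℝ)+1) < bs θ (fun x => -f x) n x / n :=
    fun k => birk_lower hE hm.neg hf.neg _ (by have : (0:ℝ) < 1/((k:ℝ)+1) := by positivity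
                                               simp only [Pi.neg_apply]; linarith)
  filter_upwards [ae_all_iff.2 h1, ae_all_iff.2 h2] with x hx1 hx2
  rw [Metric.tendsto_nhds]
  intro ε hε
  obtain ⟨k, hk⟩ := exists_nat_one_div_lt hε
  filter_upwards [hx1 k, hx2 k] with n hn1 hn2
  have e : bs θ (fun x => -f x) n x = - bs θ f n x := by simp [bs]
  rw [e, integral_neg, neg_div] at hn2
  rw [Real.dist_eq, abs_lt]
  constructor <;> linarith

lemma birkhoff_top (hE : Ergodic θ μ) {f : Ω → ℝ} (hm : Measurable f) (h0 : ∀ x, 0 ≤ f x)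
    (hf : ∫⁻ x, ENNReal.ofReal (f x) ∂μ = ⊤) :
    ∀ᵐ x ∂μ, Tendsto (fun n : ℕ => bs θ f n x / n) atTop atTop := by
  have hIntgr : ∀ M : ℕ, Integrable (fun x => min (f x) M) μ := fun M =>
    Integrable.of_bound (hm.min measurable_const).aestronglyMeasurable (M:ℝ)
      (.of_forall fun x => by
        rw [Real.norm_eq_abs, abs_of_nonneg (le_min (h0 x) (by positivity))]
        exact min_le_right _ _)
  have h1 := ae_all_iff.2 fun M : ℕ => birkhoff hE (f := fun x => min (f x) M)
    (hm.min measurable_const) (hIntgr M)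
  have h2 : Tendsto (fun M : ℕ => ∫⁻ x, ENNReal.ofReal (min (f x) M) ∂μ) atTop (𝓝 ⊤) := by
    rw [← hf]
    refine lintegral_tendsto_of_tendsto_of_monotone
      (fun M => (hm.min measurable_const).ennreal_ofReal.aemeasurable)
      (.of_forall fun x => fun a b hab => ENNReal.ofReal_le_ofReal
        (min_le_min_left _ (by exact_mod_cast hab))) (.of_forall fun x => ?_)
    refine tendsto_const_nhds.congr' ?_
    obtain ⟨N, hN⟩ := exists_nat_ge (f x)
    filter_upwards [eventually_ge_atTop N] with k hk
    rw [min_eq_left (hN.trans (by exact_mod_cast hk))]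
  filter_upwards [h1] with x hx
  rw [tendsto_atTop]
  intro C
  obtain ⟨M, hM⟩ := (h2.eventually (lt_mem_nhds (ENNReal.ofReal_lt_top (r := C)))).exists
  rw [← ofReal_integral_eq_lintegral_ofReal (hIntgr M)
    (.of_forall fun x => le_min (h0 x) (by positivity))] at hM
  have hM' : C < ∫ x, min (f x) M ∂μ := (ENNReal.ofReal_lt_ofReal_iff'.1 hM).1
  filter_upwards [(hx M).eventually (lt_mem_nhds hM')] with n hn
  refine hn.le.trans ?_
  gcongr
  unfold bs
  exact Finset.sum_le_sum fun k _ => min_le_left _ _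

lemma visits (hE : Ergodic θ μ) {A : Set Ω} (hA : MeasurableSet A) (hpos : μ A ≠ 0) :
    ∀ᵐ x ∂μ, ∃ᶠ n in atTop, θ^[n] x ∈ A := by
  have hV : MeasurableSet {x | ∃ᶠ n in atTop, θ^[n] x ∈ A} := by
    have : {x | ∃ᶠ n in atTop, θ^[n] x ∈ A} = ⋂ N : ℕ, ⋃ n : ℕ, ⋃ _ : N ≤ n, (θ^[n]) ⁻¹' A := by
      ext x; simp [frequently_atTop]
    rw [this]
    exact MeasurableSet.iInter fun N => MeasurableSet.iUnion fun n => MeasurableSet.iUnion fun _ =>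
      (hE.measurable.iterate n) hA
  have hinv : θ ⁻¹' {x | ∃ᶠ n in atTop, θ^[n] x ∈ A} = {x | ∃ᶠ n in atTop, θ^[n] x ∈ A} := by
    ext x
    simp only [mem_preimage, mem_ofPred_eq, ← Function.iterate_succ_apply]
    exact (frequently_map (m := fun n => n+1) (f := atTop) (P := fun n => θ^[n] x ∈ A)).symm.trans
      (by rw [map_add_atTop_eq_nat])
  rcases hE.toPreErgodic.ae_mem_or_ae_notMem hV hinv with h | h
  · exact h
  · exfalso
    have h3 := hE.toMeasurePreserving.conservative.ae_mem_imp_frequently_image_mem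
      hA.nullMeasurableSet
    apply hpos
    have h4 : ∀ᵐ x ∂μ, x ∉ A := by
      filter_upwards [h, h3] with x hx hx3 hxA
      exact hx (hx3 hxA)
    simpa using ae_iff.1 h4

lemma exists_bdd_level {h : Ω → ℝ} (hm : Measurable h) :
    ∃ C : ℝ, μ {x | |h x| ≤ C} ≠ 0 := by
  by_contra! hcon
  have : μ univ = 0 := by
    have e : (univ : Set Ω) = ⋃ n : ℕ, {x | |h x| ≤ n} := by
      ext x; simp only [mem_univ, mem_iUnion, mem_ofPred_eq, true_iff]; exact exists_nat_ge _
    rw [e]; exact measure_iUnion_null fun n => hcon n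
  simp at this

lemma bs_cobound (h : Ω → ℝ) (n : ℕ) (x : Ω) :
    bs θ (fun x => h (θ x) - h x) n x = h (θ^[n] x) - h x := by
  induction n generalizing x with
  | zero => simp [bs]
  | succ n ih => rw [bs_succ, ih, Function.iterate_succ_apply]; ring

lemma cobound_integral (hE : Ergodic θ μ) {h : Ω → ℝ} (hm : Measurable h)
    (hi : Integrable (fun x => h (θ x) - h x) μ) : ∫ x, (h (θ x) - h x) ∂μ = 0 := by
  obtain ⟨C, hC⟩ := exists_bdd_level (μ := μ) hm
  have h1 := birkhoff hE ((hm.comp hE.measurable).sub hm) hi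
  have h2 := visits hE (measurableSet_le hm.abs measurable_const) hC
  obtain ⟨x, hx1, hx2⟩ := (h1.and h2).exists
  by_contra hne
  set c := ∫ x, (h (θ x) - h x) ∂μ
  have h3 : ∀ᶠ n : ℕ in atTop, (C + |h x|) / n < |c| := by
    have : Tendsto (fun n : ℕ => (C + |h x|) / (n:ℝ)) atTop (𝓝 0) :=
      tendsto_const_div_atTop_nhds_zero_nat _
    exact this.eventually (gt_mem_nhds (abs_pos.2 hne))
  have h4 := hx1.abs
  have h5 : Tendsto (fun n : ℕ => (C + |h x|) / (n:ℝ)) atTop (𝓝 0) :=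
      tendsto_const_div_atTop_nhds_zero_nat _
  have h6 : |c| ≤ 0 := le_of_tendsto_of_tendsto_of_frequently h4 h5 (hx2.mono fun n hn => by
    have e := bs_cobound (θ := θ) h n x
    simp only [Function.comp_def, Pi.sub_def] at *
    rw [e, abs_div, Nat.abs_cast]
    gcongr
    exact (abs_sub _ _).trans (by simpa using hn))
  exact hne (abs_nonpos_iff.1 h6)

lemma freq_neg_of_unbdd {a : ℕ → ℝ} (h : ∀ C : ℕ, ∃ n, a n < -(C:ℝ)) : ∃ᶠ n in atTop, a n < 0 := by
  rw [frequently_atTop]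
  intro N
  obtain ⟨C, hC⟩ := exists_nat_ge (∑ k ∈ Finset.range N, |a k|)
  obtain ⟨n, hn⟩ := h C
  have hC0 : (0:ℝ) ≤ C := by positivity
  refine ⟨n, ?_, by linarith⟩
  by_contra hlt
  push Not at hlt
  have := Finset.single_le_sum (f := fun k => |a k|) (fun k _ => abs_nonneg _)
    (Finset.mem_range.2 hlt)
  have h2 := neg_abs_le (a n)
  linarith

lemma osc_cobound (hE : Ergodic θ μ) {f h : Ω → ℝ} (hm : Measurable h)
    (hfh : ∀ᵐ x ∂μ, f x = h x - h (θ x)) (hne : ¬ ∀ᵐ x ∂μ, f x = 0) :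
    ∃ᶠ x in ae μ, (∃ᶠ n in atTop, 0 < bs θ f n x) ∧ (∃ᶠ n in atTop, bs θ f n x ≤ 0) := by
  have hS : ∀ᵐ x ∂μ, ∀ n, bs θ f n x = h x - h (θ^[n] x) := by
    have : ∀ᵐ x ∂μ, ∀ k : ℕ, f (θ^[k] x) = h (θ^[k] x) - h (θ (θ^[k] x)) :=
      ae_all_iff.2 fun k => (hE.toMeasurePreserving.iterate k).quasiMeasurePreserving.ae hfh
    filter_upwards [this] with x hx n
    have h1 := bs_cobound (θ := θ) h n x
    have h2 : bs θ f n x = - bs θ (fun x => h (θ x) - h x) n x := by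
      unfold bs
      rw [← Finset.sum_neg_distrib]
      exact Finset.sum_congr rfl fun k _ => by rw [hx k]; ring
    rw [h2, h1]; ring
  have hmE : Measurable fun x => (h x : EReal) := hm.coe_real_ereal
  set s : EReal := essSup (fun x => (h x : EReal)) μ with hs
  have hle : ∀ᵐ x ∂μ, (h x : EReal) ≤ s := ae_le_essSup
  have hlt : ∀ q : ℚ, ((q:ℝ) : EReal) < s → μ {x | (q:ℝ) < h x} ≠ 0 := by
    intro q hq h0
    have : ∀ᵐ x ∂μ, (h x : EReal) ≤ ((q:ℝ):EReal) := by
      rw [ae_iff]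
      simpa using h0
    exact absurd (essSup_le_of_ae_le _ this) (not_le.2 hq)
  have hc : ∃ c : ℚ, ((c:ℝ):EReal) < s ∧ μ {x | h x ≤ c} ≠ 0 := by
    by_contra! hcon
    apply hne
    have h1 : ∀ᵐ x ∂μ, ∀ c : ℚ, ((c:ℝ):EReal) < s → (c:ℝ) < h x := by
      refine ae_all_iff.2 fun c => ?_
      by_cases hcs : ((c:ℝ):EReal) < s
      · have := hcon c hcs
        have h2 : ∀ᵐ x ∂μ, (c:ℝ) < h x := by rw [ae_iff]; simpa using this
        filter_upwards [h2] with x hx _ using hx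
      · exact .of_forall fun x hx => absurd hx hcs
    have h2 : ∀ᵐ x ∂μ, (h x : EReal) = s := by
      filter_upwards [h1, hle] with x hx1 hx2
      refine le_antisymm hx2 (le_of_not_gt fun hlt => ?_)
      obtain ⟨q, hq1, hq2⟩ := EReal.exists_rat_btwn_of_lt hlt
      have := hx1 q hq2
      exact absurd (EReal.coe_lt_coe_iff.2 this) (not_lt.2 hq1.le)
    have h3 := hE.toMeasurePreserving.quasiMeasurePreserving.ae h2
    filter_upwards [h2, h3, hfh] with x hx1 hx2 hx3
    have : h x = h (θ x) := EReal.coe_eq_coe_iff.1 (hx1.trans hx2.symm)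
    rw [hx3, this, sub_self]
  obtain ⟨c, hcs, hc⟩ := hc
  have v1 := visits hE (measurableSet_le hm measurable_const) hc
  have v2 : ∀ᵐ x ∂μ, ∀ q : ℚ, ((q:ℝ):EReal) < s → ∃ᶠ n in atTop, (q:ℝ) < h (θ^[n] x) := by
    refine ae_all_iff.2 fun q => ?_
    by_cases hq : ((q:ℝ):EReal) < s
    · filter_upwards [visits hE (measurableSet_lt measurable_const hm) (hlt q hq)] with x hx _
      exact hx
    · exact .of_forall fun x hx => absurd hx hq
  have v3 : ∀ᵐ x ∂μ, (h x : EReal) = s → ∃ᶠ n in atTop, (h (θ^[n] x) : EReal) = s := by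
    by_cases hq : μ {x | (h x : EReal) = s} = 0
    · have : ∀ᵐ x ∂μ, ¬ (h x : EReal) = s := by rw [ae_iff]; simpa using hq
      filter_upwards [this] with x hx h2 using absurd h2 hx
    · filter_upwards [visits hE (hmE (measurableSet_singleton s)) hq] with x hx _ using hx
  have v0 : ∃ᶠ x in ae μ, (c:ℝ) < h x := frequently_ae_iff.2 (hlt c hcs)
  refine (v0.and_eventually (hS.and (hle.and (v1.and (v2.and v3))))).mono ?_
  rintro x ⟨hx0, hxS, hxle, hx1, hx2, hx3⟩
  refine ⟨hx1.mono fun n hn => ?_, ?_⟩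
  · rw [hxS]
    have : h (θ^[n] x) ≤ c := hn
    linarith
  · rcases hxle.lt_or_eq with hl | he
    · obtain ⟨q, hq1, hq2⟩ := EReal.exists_rat_btwn_of_lt hl
      refine (hx2 q hq2).mono fun n hn => ?_
      rw [hxS]
      have := EReal.coe_lt_coe_iff.1 hq1
      linarith
    · refine (hx3 he).mono fun n hn => ?_
      rw [hxS, EReal.coe_eq_coe_iff.1 (hn.trans he.symm), sub_self]

lemma cobound_of_bddBelow (hE : Ergodic θ μ) {f : Ω → ℝ} (hm : Measurable f)
    (hf : Integrable f μ) (h0 : ∫ x, f x ∂μ = 0)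
    (hb : ∀ᵐ x ∂μ, ¬ ∀ C : ℕ, ∃ n, bs θ f n x < -(C:ℝ)) :
    ∃ h : Ω → ℝ, Measurable h ∧ ∀ᵐ x ∂μ, f x = h x - h (θ x) := by
  have hbd : ∀ x, (¬ ∀ C : ℕ, ∃ n, bs θ f n x < -(C:ℝ)) → 
      Tendsto (fun n => rmin θ f n x) atTop (𝓝 (⨅ n, rmin θ f n x)) := by
    intro x hx
    push Not at hx
    obtain ⟨C, hC⟩ := hx
    refine tendsto_atTop_ciInf (rmin_anti' f x) ⟨-(C:ℝ), ?_⟩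
    rintro _ ⟨n, rfl⟩
    obtain ⟨k, hk⟩ := exists_bs_eq_rmin (θ := θ) f n x
    simp only
    rw [hk]; exact hC k
  set h : Ω → ℝ := fun x => ⨅ n, rmin θ f n x with hh
  have hhm : Measurable h := Measurable.iInf fun n => rmin_meas hE.measurable hm n
  have hle0 : ∀ x, (¬ ∀ C : ℕ, ∃ n, bs θ f n x < -(C:ℝ)) → h x ≤ 0 := fun x hx =>
    le_of_tendsto' (hbd x hx) fun n => rmin_nonpos f n x
  have hrec : ∀ᵐ x ∂μ, h x = min 0 (f x + h (θ x)) ∧ h (θ x) ≤ 0 := by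
    filter_upwards [hb] with x hx
    have hx2 : ¬ ∀ C : ℕ, ∃ n, bs θ f n (θ x) < -(C:ℝ) := by
      intro h
      exact hx ((Set.ext_iff.1 (unbdd_inv (θ := θ) f) x).1 h)
    have t1 := (tendsto_add_atTop_iff_nat 1).2 (hbd x hx)
    have t2 := (tendsto_const_nhds (x := (0:ℝ))).min ((hbd _ hx2).const_add (f x))
    exact ⟨tendsto_nhds_unique t1 t2, hle0 _ hx2⟩
  refine ⟨h, hhm, ?_⟩
  set u : Ω → ℝ := fun x => f x + h (θ x) - h x with hu
  have hum : Measurable u := (hm.add (hhm.comp hE.measurable)).sub hhm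
  have hu0 : ∀ᵐ x ∂μ, 0 ≤ u x := by
    filter_upwards [hrec] with x hx
    have := min_le_right 0 (f x + h (θ x))
    simp only [hu]; linarith [hx.1]
  have hui : Integrable u μ := by
    refine hf.mono hum.aestronglyMeasurable ?_
    filter_upwards [hrec, hu0] with x hx hx0
    rw [Real.norm_eq_abs, Real.norm_eq_abs, abs_of_nonneg hx0]
    simp only [hu]
    rcases min_choice 0 (f x + h (θ x)) with e | e
    · rw [hx.1, e]; linarith [hx.2, le_abs_self (f x)]
    · have h3 := hx.1
      rw [e] at h3
      rw [← h3, sub_self]; exact abs_nonneg _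
  have hci : Integrable (fun x => h (θ x) - h x) μ := by
    have := hui.sub hf
    refine this.congr (.of_forall fun x => ?_)
    simp [hu]; ring
  have hz := cobound_integral hE hhm hci
  have huz : ∫ x, u x ∂μ = 0 := by
    have : u = fun x => f x + (h (θ x) - h x) := by funext x; simp [hu]; ring
    rw [this, integral_add hf hci, h0, hz, add_zero]
  have := (integral_eq_zero_iff_of_nonneg_ae hu0 hui).1 huz
  filter_upwards [this] with x hx
  simp only [hu, Pi.zero_apply] at hx
  linarith

lemma oscillation (hE : Ergodic θ μ) {f : Ω → ℝ} (hm : Measurable f)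
    (hf : Integrable f μ) (h0 : ∫ x, f x ∂μ = 0) (hne : ¬ ∀ᵐ x ∂μ, f x = 0) :
    ∃ᶠ x in ae μ, (∃ᶠ n in atTop, 0 < bs θ f n x) ∧ (∃ᶠ n in atTop, bs θ f n x ≤ 0) := by
  have inst : (ae μ).NeBot := inferInstance
  rcases hE.toPreErgodic.ae_mem_or_ae_notMem (unbdd_meas hE.measurable hm) (unbdd_inv f) with h | h
  · rcases hE.toPreErgodic.ae_mem_or_ae_notMem (unbdd_meas hE.measurable hm.neg)
      (unbdd_inv (-f)) with h' | h'
    · refine Eventually.frequently ?_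
      filter_upwards [h, h'] with x hx hx'
      refine ⟨(freq_neg_of_unbdd hx').mono fun n hn => ?_, (freq_neg_of_unbdd hx).mono fun n hn => hn.le⟩
      have : bs θ (-f) n x = - bs θ f n x := by simp [bs]
      rw [this] at hn; linarith
    · obtain ⟨g, hg, hg2⟩ := cobound_of_bddBelow hE hm.neg hf.neg (by
        simp only [Pi.neg_apply]; rw [integral_neg, h0, neg_zero]) h'
      refine osc_cobound hE hg.neg ?_ hne
      filter_upwards [hg2] with x hx
      simp only [Pi.neg_apply] at hx ⊢
      linarith
  · obtain ⟨g, hg, hg2⟩ := cobound_of_bddBelow hE hm hf h0 h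
    exact osc_cobound hE hg hg2 hne

end Erg
end GAEP

namespace GAEP

section Single
variable {T : Type*} [MeasurableSpace T] {Q : Measure T} [IsProbabilityMeasure Q] {r : T → ℝ}

/-- Laplace transform -/
def Zr (Q : Measure T) (r : T → ℝ) (t : ℝ) : ℝ := ∫ y, Real.exp (-(t * r y)) ∂Q
/-- negative log Laplace transform -/
def gr (Q : Measure T) (r : T → ℝ) (t : ℝ) : ℝ := -Real.log (Zr Q r t)

lemma exp_int (hm : Measurable r) (h0 : ∀ y, 0 ≤ r y) {t : ℝ} (ht : 0 ≤ t) :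
    Integrable (fun y => Real.exp (-(t * r y))) Q :=
  Integrable.of_bound (by fun_prop) 1 (.of_forall fun y => by
    rw [Real.norm_eq_abs, abs_of_pos (Real.exp_pos _), Real.exp_le_one_iff]
    have := mul_nonneg ht (h0 y); linarith)

lemma Zr_pos (hm : Measurable r) (h0 : ∀ y, 0 ≤ r y) {t : ℝ} (ht : 0 ≤ t) : 0 < Zr Q r t :=
  integral_exp_pos (exp_int hm h0 ht)

lemma Zr_zero : Zr Q r 0 = 1 := by simp [Zr]

lemma gr_zero : gr Q r 0 = 0 := by simp [gr, Zr_zero]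

lemma Zr_anti (hm : Measurable r) (h0 : ∀ y, 0 ≤ r y) {s t : ℝ} (hs : 0 ≤ s) (hst : s ≤ t) :
    Zr Q r t ≤ Zr Q r s :=
  integral_mono (exp_int hm h0 (hs.trans hst)) (exp_int hm h0 hs) fun y => by
    have := mul_le_mul_of_nonneg_right hst (h0 y)
    exact Real.exp_le_exp.2 (by linarith)

lemma gr_mono (hm : Measurable r) (h0 : ∀ y, 0 ≤ r y) {s t : ℝ} (hs : 0 ≤ s) (hst : s ≤ t) :
    gr Q r s ≤ gr Q r t :=
  neg_le_neg (Real.log_le_log (Zr_pos hm h0 (hs.trans hst)) (Zr_anti hm h0 hs hst))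

lemma gr_nonneg (hm : Measurable r) (h0 : ∀ y, 0 ≤ r y) {t : ℝ} (ht : 0 ≤ t) : 0 ≤ gr Q r t := by
  rw [← gr_zero (Q := Q) (r := r)]; exact gr_mono hm h0 le_rfl ht

lemma exp_neg_gr (hm : Measurable r) (h0 : ∀ y, 0 ≤ r y) {t : ℝ} (ht : 0 ≤ t) :
    Real.exp (-gr Q r t) = Zr Q r t := by
  rw [gr, neg_neg, Real.exp_log (Zr_pos hm h0 ht)]

lemma gr_ratio (hm : Measurable r) (h0 : ∀ y, 0 ≤ r y) {s t : ℝ} (hs : 0 < s) (hst : s ≤ t) :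
    gr Q r t ≤ t / s * gr Q r s := by
  set p := t / s with hp
  have hp1 : 1 ≤ p := (one_le_div hs).2 hst
  set z := Zr Q r s with hz
  have hz0 : 0 < z := Zr_pos hm h0 hs.le
  have key : ∀ y, 1 + p * (Real.exp (-(s * r y)) / z - 1) ≤ Real.exp (-(t * r y)) / z ^ p := by
    intro y
    have hpos : 0 < Real.exp (-(s * r y)) / z := by positivity
    have := one_add_mul_self_le_rpow_one_add (s := Real.exp (-(s * r y)) / z - 1)
      (by linarith) hp1
    refine this.trans_eq ?_
    rw [add_sub_cancel, Real.div_rpow (Real.exp_pos _).le hz0.le, ← Real.exp_mul]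
    congr 2
    rw [hp]; field_simp
  have i1 := exp_int (Q := Q) hm h0 hs.le
  have i2 := exp_int (Q := Q) hm h0 (hs.le.trans hst)
  have i3 : Integrable (fun y => 1 + p * (Real.exp (-(s * r y)) / z - 1)) Q :=
    (integrable_const _).add (((i1.div_const _).sub (integrable_const _)).const_mul _)
  have h1 := integral_mono i3 (i2.div_const (z ^ p)) key
  have h2 : ∫ y, (1 + p * (Real.exp (-(s * r y)) / z - 1)) ∂Q = 1 := by
    have i4 : Integrable (fun y => Real.exp (-(s * r y)) / z - 1) Q :=
      (i1.div_const _).sub (integrable_const _)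
    rw [integral_add (integrable_const _) (i4.const_mul _), integral_const_mul,
      integral_sub (i1.div_const _) (integrable_const _), integral_div]
    have : ∫ y, Real.exp (-(s * r y)) ∂Q = z := rfl
    rw [this, div_self hz0.ne']; simp
  rw [h2, integral_div] at h1
  have h3 : z ^ p ≤ Zr Q r t := by
    rw [le_div_iff₀ (by positivity), one_mul] at h1; exact h1
  have h4 := Real.log_le_log (by positivity) h3
  rw [Real.log_rpow hz0] at h4
  unfold gr
  rw [← hz]; linarith

lemma gr_le_max (hm : Measurable r) (h0 : ∀ y, 0 ≤ r y) {t : ℝ} (ht : 0 ≤ t) :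
    gr Q r t ≤ max 1 t * gr Q r 1 := by
  have hg := gr_nonneg (Q := Q) hm h0 zero_le_one
  rcases le_total t 1 with h | h
  · rw [max_eq_left h, one_mul]; exact gr_mono hm h0 ht h
  · rw [max_eq_right h]; simpa using gr_ratio (Q := Q) hm h0 one_pos h

lemma gr_lip (hm : Measurable r) (h0 : ∀ y, 0 ≤ r y) {a s t : ℝ} (ha : 0 < a) (has : a ≤ s)
    (hst : s ≤ t) :
    |gr Q r t - gr Q r s| ≤ (max 1 t / a * gr Q r 1) * |t - s| := by
  have hs : 0 < s := ha.trans_le has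
  have h1 := gr_mono (Q := Q) hm h0 hs.le hst
  have h2 := gr_ratio (Q := Q) hm h0 hs hst
  have h3 := gr_le_max (Q := Q) hm h0 hs.le
  have hg := gr_nonneg (Q := Q) hm h0 zero_le_one
  rw [abs_of_nonneg (by linarith), abs_of_nonneg (by linarith)]
  have h4 : gr Q r t - gr Q r s ≤ (gr Q r s / s) * (t - s) := by
    have : t / s * gr Q r s = (gr Q r s / s) * t := by ring
    have h5 : (gr Q r s / s) * s = gr Q r s := by field_simp
    nlinarith
  refine h4.trans (mul_le_mul_of_nonneg_right ?_ (by linarith))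
  calc gr Q r s / s ≤ (max 1 t * gr Q r 1) / a := by
        apply div_le_div₀
        · exact mul_nonneg (by positivity) hg
        · exact h3.trans (mul_le_mul_of_nonneg_right (max_le_max_left _ hst) hg)
        · exact ha
        · exact has
    _ = _ := by ring

lemma gr_hasDeriv (hm : Measurable r) (h0 : ∀ y, 0 ≤ r y) {t : ℝ} (ht : 0 < t) :
    HasDerivAt (gr Q r) (-((∫ y, (-r y) * Real.exp (t * (-r y)) ∂Q) / Zr Q r t)) t := by
  have hmem : t ∈ interior (ProbabilityTheory.integrableExpSet (fun y => -r y) Q) := by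
    rw [mem_interior]
    refine ⟨Ioi 0, fun s hs => ?_, isOpen_Ioi, ht⟩
    have := exp_int (Q := Q) hm h0 (le_of_lt hs)
    simpa [ProbabilityTheory.integrableExpSet] using this
  have h1 := ProbabilityTheory.hasDerivAt_mgf hmem
  have h2 : ProbabilityTheory.mgf (fun y => -r y) Q = Zr Q r := by
    funext s; simp [ProbabilityTheory.mgf, Zr]
  rw [h2] at h1
  exact (h1.log (Zr_pos hm h0 ht.le).ne').neg

lemma gr_cont (hm : Measurable r) (h0 : ∀ y, 0 ≤ r y) : ContinuousOn (gr Q r) (Ici 0) := by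
  have : ContinuousOn (Zr Q r) (Ici 0) := by
    intro t ht
    refine tendsto_integral_filter_of_dominated_convergence (fun _ => 1)
      (.of_forall fun s => by fun_prop) ?_ (integrable_const _) (.of_forall fun y => ?_)
    · filter_upwards [self_mem_nhdsWithin] with s hs
      refine .of_forall fun y => ?_
      rw [Real.norm_eq_abs, abs_of_pos (Real.exp_pos _), Real.exp_le_one_iff]
      have := mul_nonneg hs (h0 y); linarith
    · have : Continuous fun s : ℝ => Real.exp (-(s * r y)) := by fun_prop
      exact this.continuousAt.continuousWithinAt
  exact (this.log fun t ht => (Zr_pos hm h0 ht).ne').neg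

lemma level_pos (hm : Measurable r) : ∃ C : ℝ, Q {y | r y ≤ C} ≠ 0 := by
  obtain ⟨C, hC⟩ := exists_bdd_level (μ := Q) hm
  refine ⟨C, fun h => hC (measure_mono_null ?_ h)⟩
  intro y hy
  exact (le_abs_self (r y)).trans hy

lemma ess_bdd (h0 : ∀ y, 0 ≤ r y) : IsBoundedUnder (· ≥ ·) (ae Q) r :=
  ⟨0, by simpa using Eventually.of_forall h0⟩

lemma ess_cobdd (hm : Measurable r) : IsCoboundedUnder (· ≥ ·) (ae Q) r := by
  obtain ⟨C, hC⟩ := level_pos (Q := Q) hm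
  refine ⟨C, fun a ha => ?_⟩
  rw [eventually_map] at ha
  have : ∃ᶠ y in ae Q, r y ≤ C := frequently_ae_iff.2 hC
  obtain ⟨y, h1, h2⟩ := (this.and_eventually ha).exists
  exact le_trans h2 h1

lemma ess_le (h0 : ∀ y, 0 ≤ r y) : ∀ᵐ y ∂Q, essInf r Q ≤ r y := ae_essInf_le (ess_bdd h0)

lemma ess_nonneg (hm : Measurable r) (h0 : ∀ y, 0 ≤ r y) : 0 ≤ essInf r Q :=
  le_essInf_of_ae_le 0 (.of_forall h0) (ess_cobdd hm)

lemma ess_level (hm : Measurable r) {c : ℝ} (hc : essInf r Q < c) : Q {y | r y ≤ c} ≠ 0 := by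
  intro h
  have : ∀ᵐ y ∂Q, c ≤ r y := by
    have : ∀ᵐ y ∂Q, ¬ r y ≤ c := by rw [ae_iff]; simpa using h
    filter_upwards [this] with y hy using (not_le.1 hy).le
  exact absurd (le_essInf_of_ae_le c this (ess_cobdd hm)) (not_le.2 hc)

/-- `-log ∫ e^{-t (r - r0)}` -/
lemma gr_shift (hm : Measurable r) (h0 : ∀ y, 0 ≤ r y) {t : ℝ} (ht : 0 ≤ t) (c : ℝ) :
    gr Q r t - t * c = -Real.log (∫ y, Real.exp (-(t * (r y - c))) ∂Q) := by
  have : ∀ y, Real.exp (-(t * (r y - c))) = Real.exp (t * c) * Real.exp (-(t * r y)) := by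
    intro y; rw [← Real.exp_add]; congr 1; ring
  simp_rw [this]
  rw [integral_const_mul, Real.log_mul (Real.exp_pos _).ne', Real.log_exp, gr, Zr]
  · ring
  · exact (Zr_pos hm h0 ht).ne'

lemma exp_int' (hm : Measurable r) (h0 : ∀ y, 0 ≤ r y) {t : ℝ} (ht : 0 ≤ t) (c : ℝ) :
    Integrable (fun y => Real.exp (-(t * (r y - c)))) Q := by
  have : ∀ y, Real.exp (-(t * (r y - c))) = Real.exp (t * c) * Real.exp (-(t * r y)) := by
    intro y; rw [← Real.exp_add]; congr 1; ring
  simp_rw [this]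
  exact (exp_int hm h0 ht).const_mul _

lemma gr_shift_mono (hm : Measurable r) (h0 : ∀ y, 0 ≤ r y) {s t : ℝ} (hs : 0 ≤ s)
    (hst : s ≤ t) : gr Q r s - s * essInf r Q ≤ gr Q r t - t * essInf r Q := by
  rw [gr_shift hm h0 hs, gr_shift hm h0 (hs.trans hst)]
  refine neg_le_neg (Real.log_le_log (integral_exp_pos (exp_int' hm h0 (hs.trans hst) _)) ?_)
  refine integral_mono_ae (exp_int' hm h0 (hs.trans hst) _) (exp_int' hm h0 hs _) ?_
  filter_upwards [ess_le h0] with y hy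
  have := mul_le_mul_of_nonneg_right hst (sub_nonneg.2 hy)
  exact Real.exp_le_exp.2 (by linarith)

lemma gr_ge (hm : Measurable r) (h0 : ∀ y, 0 ≤ r y) {t : ℝ} (ht : 0 ≤ t) :
    t * essInf r Q ≤ gr Q r t := by
  have := gr_shift_mono (Q := Q) hm h0 le_rfl ht
  rw [gr_zero] at this; linarith

lemma gr_le_level (hm : Measurable r) (h0 : ∀ y, 0 ≤ r y) {t : ℝ} (ht : 0 ≤ t) {c : ℝ}
    (hc : Q {y | r y ≤ c} ≠ 0) : gr Q r t ≤ t * c - Real.log (Q.real {y | r y ≤ c}) := by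
  have hs : MeasurableSet {y | r y ≤ c} := measurableSet_le hm measurable_const
  have hq : 0 < Q.real {y | r y ≤ c} := ENNReal.toReal_pos hc (measure_ne_top _ _)
  have : Real.exp (-(t * c)) * Q.real {y | r y ≤ c} ≤ Zr Q r t := by
    have e : Real.exp (-(t * c)) * Q.real {y | r y ≤ c}
        = ∫ y, {y | r y ≤ c}.indicator (fun _ => Real.exp (-(t * c))) y ∂Q := by
      rw [integral_indicator_const _ hs, smul_eq_mul, mul_comm]
    rw [e]
    refine integral_mono ((integrable_const _).indicator hs) (exp_int hm h0 ht) fun y => ?_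
    by_cases hy : y ∈ {y | r y ≤ c}
    · rw [indicator_of_mem hy]
      have := mul_le_mul_of_nonneg_left (show r y ≤ c from hy) ht
      exact Real.exp_le_exp.2 (by linarith)
    · rw [indicator_of_notMem hy]; exact (Real.exp_pos _).le
  have h2 := Real.log_le_log (by positivity) this
  rw [Real.log_mul (Real.exp_pos _).ne' hq.ne', Real.log_exp] at h2
  unfold gr; linarith

lemma gr_div_tendsto (hm : Measurable r) (h0 : ∀ y, 0 ≤ r y) :
    Tendsto (fun n : ℕ => gr Q r n / n) atTop (𝓝 (essInf r Q)) := by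
  rw [tendsto_order]
  constructor
  · intro a ha
    filter_upwards [eventually_gt_atTop 0] with n hn
    have hn' : (0:ℝ) < n := by exact_mod_cast hn
    refine ha.trans_le ?_
    rw [le_div_iff₀ hn', mul_comm]; exact gr_ge hm h0 hn'.le
  · intro b hb
    obtain ⟨c, hc1, hc2⟩ := exists_between hb
    have hl := ess_level (Q := Q) hm hc1
    have ht : Tendsto (fun n : ℕ => c + (-Real.log (Q.real {y | r y ≤ c})) / (n:ℝ)) atTop (𝓝 (c + 0)) :=
      (tendsto_const_div_atTop_nhds_zero_nat _).const_add c
    rw [add_zero] at ht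
    filter_upwards [eventually_gt_atTop 0, ht.eventually (gt_mem_nhds hc2)] with n hn hn2
    have hn' : (0:ℝ) < n := by exact_mod_cast hn
    refine lt_of_le_of_lt ?_ hn2
    have := gr_le_level hm h0 hn'.le hl
    rw [div_le_iff₀ hn', add_mul, div_mul_cancel₀ _ hn'.ne']
    linarith

lemma negLog_tendsto {z : ℕ → ℝ} {q : ℝ≥0∞} (hq : q ≠ ⊤) (hz : ∀ n, 0 < z n)
    (h : Tendsto z atTop (𝓝 q.toReal)) :
    Tendsto (fun n => ENNReal.ofReal (-Real.log (z n))) atTop (𝓝 (negLog q)) := by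
  unfold negLog
  split_ifs with h0
  · rw [h0, ENNReal.toReal_zero] at h
    refine ENNReal.tendsto_ofReal_atTop.comp ?_
    have : Tendsto z atTop (𝓝[>] 0) :=
      tendsto_nhdsWithin_iff.2 ⟨h, .of_forall hz⟩
    exact tendsto_neg_atBot_atTop.comp (Real.tendsto_log_nhdsGT_zero.comp this)
  · have hpos : 0 < q.toReal := ENNReal.toReal_pos h0 hq
    exact ENNReal.tendsto_ofReal ((h.log hpos.ne').neg)

lemma gr_shift_tendsto (hm : Measurable r) (h0 : ∀ y, 0 ≤ r y) :
    Tendsto (fun n : ℕ => ENNReal.ofReal (gr Q r n - n * essInf r Q)) atTop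
      (𝓝 (negLog (Q {y | r y = essInf r Q}))) := by
  have : ∀ n : ℕ, gr Q r n - n * essInf r Q
      = -Real.log (∫ y, Real.exp (-((n:ℝ) * (r y - essInf r Q))) ∂Q) :=
    fun n => gr_shift hm h0 (by positivity) _
  simp_rw [this]
  have hs : MeasurableSet {y | r y = essInf r Q} := hm (measurableSet_singleton _)
  refine negLog_tendsto (measure_ne_top _ _)
    (fun n => integral_exp_pos (exp_int' hm h0 (by positivity) _)) ?_
  have e : (Q {y | r y = essInf r Q}).toReal
      = ∫ y, {y | r y = essInf r Q}.indicator (fun _ => (1:ℝ)) y ∂Q := by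
    rw [integral_indicator_const _ hs]; simp [Measure.real]
  rw [e]
  refine tendsto_integral_of_dominated_convergence (fun _ => 1)
    (fun n => by fun_prop) (integrable_const _) (fun n => ?_) ?_
  · filter_upwards [ess_le h0] with y hy
    rw [Real.norm_eq_abs, abs_of_pos (Real.exp_pos _), Real.exp_le_one_iff]
    have := mul_nonneg (Nat.cast_nonneg (α := ℝ) n) (sub_nonneg.2 hy); linarith
  · filter_upwards [ess_le h0] with y hy
    rcases hy.eq_or_lt with he | hl
    · rw [indicator_of_mem (by exact he.symm)]
      rw [← he]; simp
    · rw [indicator_of_notMem (by exact hl.ne')]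
      refine Real.tendsto_exp_neg_atTop_nhds_zero.comp ?_
      exact tendsto_natCast_atTop_atTop.atTop_mul_const (sub_pos.2 hl)

end Single
end GAEP

namespace GAEP

/-- Variational lemma for the concave function `Γ`. -/
lemma variational {Γ : ℝ → ℝ} (hc : ContinuousOn Γ (Ici 0)) (hΓ0 : Γ 0 = 0)
    (hmono : ∀ s t, 0 ≤ s → s ≤ t → Γ s ≤ Γ t)
    (hratio : ∀ s t, 0 < s → s ≤ t → Γ t ≤ t / s * Γ s)
    (hd : ∀ t, 0 < t → DifferentiableAt ℝ Γ t) {d D : ℝ} (hdD : d < D)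
    (hlim : Tendsto (fun n : ℕ => Γ n / n) atTop (𝓝 d)) :
    ∃ l : ℝ, 0 ≤ l ∧ (∃ t, 0 ≤ t ∧ Γ t - t * D = l) ∧
      ∀ ε > 0, ∃ t a s s' : ℝ, 0 < t ∧ 0 < s ∧ s ≤ t ∧ 0 < s' ∧ Γ t - Γ (t - s) < s * D ∧
        s' * a < Γ (t + s') - Γ t ∧ Γ t - t * a < l + ε := by
  obtain ⟨D1, h1, h2⟩ := exists_between hdD
  obtain ⟨N, hN1, hN2⟩ := ((hlim.eventually (gt_mem_nhds h1)).and (eventually_gt_atTop 0)).exists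
  have hN0 : (0:ℝ) < N := by exact_mod_cast hN2
  set τ : ℝ := (N : ℝ) with hτ
  have hneg : ∀ t, τ ≤ t → Γ t ≤ t * D1 := by
    intro t ht
    refine (hratio τ t hN0 ht).trans ?_
    have : t / τ * Γ τ = t * (Γ τ / τ) := by ring
    rw [this]
    exact mul_le_mul_of_nonneg_left hN1.le (hN0.le.trans ht)
  have hmax : ∀ D', D1 ≤ D' → ∃ t0, 0 ≤ t0 ∧ t0 ≤ τ ∧ ∀ t, 0 ≤ t → Γ t - t * D' ≤ Γ t0 - t0 * D' := by
    intro D' hD'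
    have hcont : ContinuousOn (fun t => Γ t - t * D') (Icc 0 τ) :=
      (hc.mono Icc_subset_Ici_self).sub (by fun_prop)
    obtain ⟨t0, ht0, hm⟩ := isCompact_Icc.exists_isMaxOn ⟨0, by simp [hN0.le]⟩ hcont
    refine ⟨t0, ht0.1, ht0.2, fun t ht => ?_⟩
    rcases le_total t τ with h | h
    · exact hm ⟨ht, h⟩
    · have h3 : Γ 0 - 0 * D' ≤ Γ t0 - t0 * D' := hm ⟨le_rfl, hN0.le⟩
      rw [hΓ0] at h3
      have h4 := hneg t h
      have h5 := mul_le_mul_of_nonneg_left hD' ht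
      linarith
  obtain ⟨t0, ht0, ht0τ, hm0⟩ := hmax D h2.le
  have hl0 : 0 ≤ Γ t0 - t0 * D := by have := hm0 0 le_rfl; rw [hΓ0] at this; linarith
  refine ⟨Γ t0 - t0 * D, hl0, ⟨t0, ht0, rfl⟩, fun ε hε => ?_⟩
  set δ := ε / (4 * (τ + 1)) with hδ
  have hδ0 : 0 < δ := by positivity
  have hδτ : τ * δ ≤ ε / 4 := by
    rw [hδ]
    rw [mul_div_assoc', div_le_div_iff₀ (by positivity) (by norm_num)]
    nlinarith
  set D' := max D1 (D - δ) with hD'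
  have hD'D : D' < D := max_lt h2 (by linarith)
  have hD'δ : D - D' ≤ δ := by have := le_max_right D1 (D - δ); linarith
  obtain ⟨t', ht'0, ht'τ, hm'⟩ := hmax D' (le_max_left _ _)
  have hφ : Γ t' - t' * D' ≤ Γ t0 - t0 * D + ε / 4 := by
    have h3 := hm0 t' ht'0
    have h4 : t' * (D - D') ≤ τ * δ := mul_le_mul ht'τ hD'δ (by linarith) hN0.le
    nlinarith
  rcases ht'0.eq_or_lt with h | hpos
  · rw [← h, hΓ0] at hm'
    have hm2 : ∀ t, 0 ≤ t → Γ t ≤ t * D' := fun t ht => by have := hm' t ht; linarith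
    set t := ε / (2 * (|D'| + 1)) with ht
    have ht0 : 0 < t := by positivity
    have htD : t * (|D'| + 1) = ε / 2 := by rw [ht]; field_simp
    refine ⟨t, -1, t/2, 1, ht0, by linarith, by linarith, one_pos, ?_, ?_, ?_⟩
    · have h3 := hratio (t/2) t (by linarith) (by linarith)
      have h4 : t / (t/2) = 2 := by field_simp
      rw [h4] at h3
      have h5 := hm2 t ht0.le
      have e : t - t/2 = t/2 := by ring
      rw [e]
      nlinarith
    · have := hmono t (t+1) ht0.le (by linarith); linarith
    · have h5 := hm2 t ht0.le
      have h6 := le_abs_self D'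
      nlinarith
  · have hloc : IsLocalMax (fun t => Γ t - t * D') t' := by
      filter_upwards [lt_mem_nhds hpos] with t ht
      exact hm' t ht.le
    have hdd : HasDerivAt (fun t => Γ t - t * D') (deriv Γ t' - 1 * D') t' :=
      (hd t' hpos).hasDerivAt.sub ((hasDerivAt_id t').mul_const D')
    have hz := hloc.hasDerivAt_eq_zero hdd
    have hD : HasDerivAt Γ D' t' := by
      have := (hd t' hpos).hasDerivAt
      rwa [show deriv Γ t' = D' by linarith] at this
    have hslope := hasDerivAt_iff_tendsto_slope.1 hD
    have hL : Tendsto (slope Γ t') (𝓝[<] t') (𝓝 D') :=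
      hslope.mono_left (nhdsWithin_mono _ fun x hx => ne_of_lt hx)
    have hR : Tendsto (slope Γ t') (𝓝[>] t') (𝓝 D') :=
      hslope.mono_left (nhdsWithin_mono _ fun x hx => ne_of_gt hx)
    obtain ⟨u, ⟨hu1, hu2⟩, hu3⟩ := ((hL.eventually (gt_mem_nhds hD'D)).and
      (self_mem_nhdsWithin) |>.and (mem_nhdsWithin_of_mem_nhds (lt_mem_nhds hpos))).exists
    obtain ⟨v, hv1, hv2⟩ := ((hR.eventually (lt_mem_nhds (show D' - δ < D' by linarith))).and
      (self_mem_nhdsWithin)).exists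
    have hu2 : u < t' := hu2
    have hv2 : t' < v := hv2
    refine ⟨t', D' - δ, t' - u, v - t', hpos, by linarith, ?_, by linarith, ?_, ?_, ?_⟩
    · have : 0 < u := hu3
      linarith
    · rw [sub_sub_cancel]
      rw [slope_comm, slope_def_field, div_lt_iff₀ (by linarith)] at hu1
      linarith
    · rw [add_sub_cancel]
      rw [slope_def_field, lt_div_iff₀ (by linarith)] at hv1
      linarith
    · have : t' * δ ≤ τ * δ := mul_le_mul_of_nonneg_right ht'τ hδ0.le
      nlinarith

section Joint
variable {S T : Type*} [MeasurableSpace S] [MeasurableSpace T] {P : Measure S} {Q : Measure T}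
  [IsProbabilityMeasure P] [IsProbabilityMeasure Q] {ρ : S × T → ℝ}

/-- `-log E_Q e^{-tρ(x,Y)}` -/
def g (ρ : S × T → ℝ) (Q : Measure T) (t : ℝ) (x : S) : ℝ := gr Q (fun y => ρ (x, y)) t

/-- `E_P g_t` -/
def Gam (ρ : S × T → ℝ) (P : Measure S) (Q : Measure T) (t : ℝ) : ℝ := ∫ x, g ρ Q t x ∂P

/-- `-log Q(ρ(x,Y) = ρ_Q(x))` -/
def kx (ρ : S × T → ℝ) (Q : Measure T) (x : S) : ℝ≥0∞ := negLog (Q {y | ρ (x, y) = rhoQ ρ Q x})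

lemma secm (hρm : Measurable ρ) (x : S) : Measurable fun y => ρ (x, y) :=
  hρm.comp measurable_prodMk_left

lemma g_meas (hρm : Measurable ρ) (t : ℝ) : Measurable (g ρ Q t) := by
  have : StronglyMeasurable fun x => ∫ y, Real.exp (-(t * ρ (x, y))) ∂Q :=
    StronglyMeasurable.integral_prod_right (f := fun x y => Real.exp (-(t * ρ (x, y))))
      (Measurable.stronglyMeasurable (by fun_prop))
  exact (this.measurable.log).neg

lemma rhoQ_meas (hρm : Measurable ρ) (h0 : ∀ z, 0 ≤ ρ z) : Measurable (rhoQ ρ Q) :=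
  measurable_of_tendsto_metrizable (f := fun (n : ℕ) x => g ρ Q n x / n)
    (fun n => (g_meas hρm n).div_const _)
    (tendsto_pi_nhds.2 fun x => gr_div_tendsto (secm hρm x) fun y => h0 _)

lemma kx_meas (hρm : Measurable ρ) (h0 : ∀ z, 0 ≤ ρ z) : Measurable (kx ρ Q) :=
  measurable_of_tendsto_metrizable
    (f := fun (n : ℕ) x => ENNReal.ofReal (g ρ Q n x - n * rhoQ ρ Q x))
    (fun n => ((g_meas hρm n).sub ((rhoQ_meas hρm h0).const_mul _)).ennreal_ofReal)
    (tendsto_pi_nhds.2 fun x => gr_shift_tendsto (secm hρm x) fun y => h0 _)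

lemma g_nonneg (hρm : Measurable ρ) (h0 : ∀ z, 0 ≤ ρ z) {t : ℝ} (ht : 0 ≤ t) (x : S) :
    0 ≤ g ρ Q t x := gr_nonneg (secm hρm x) (fun _ => h0 _) ht

lemma g_int (hρm : Measurable ρ) (h0 : ∀ z, 0 ≤ ρ z) (hG : Integrable (g ρ Q 1) P) {t : ℝ}
    (ht : 0 ≤ t) : Integrable (g ρ Q t) P := by
  refine (hG.const_mul (max 1 t)).mono' (g_meas hρm t).aestronglyMeasurable (.of_forall fun x => ?_)
  rw [Real.norm_eq_abs, abs_of_nonneg (g_nonneg hρm h0 ht x)]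
  exact gr_le_max (secm hρm x) (fun _ => h0 _) ht

lemma Gam_zero : Gam ρ P Q 0 = 0 := by simp [Gam, g, gr_zero]

lemma Gam_mono (hρm : Measurable ρ) (h0 : ∀ z, 0 ≤ ρ z) (hG : Integrable (g ρ Q 1) P) (s t : ℝ)
    (hs : 0 ≤ s) (hst : s ≤ t) : Gam ρ P Q s ≤ Gam ρ P Q t :=
  integral_mono (g_int hρm h0 hG hs) (g_int hρm h0 hG (hs.trans hst)) fun x =>
    gr_mono (secm hρm x) (fun _ => h0 _) hs hst

lemma Gam_ratio (hρm : Measurable ρ) (h0 : ∀ z, 0 ≤ ρ z) (hG : Integrable (g ρ Q 1) P) (s t : ℝ)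
    (hs : 0 < s) (hst : s ≤ t) : Gam ρ P Q t ≤ t / s * Gam ρ P Q s := by
  unfold Gam
  rw [← integral_const_mul]
  exact integral_mono (g_int hρm h0 hG (hs.le.trans hst)) ((g_int hρm h0 hG hs.le).const_mul _)
    fun x => gr_ratio (secm hρm x) (fun _ => h0 _) hs hst

lemma Gam_cont (hρm : Measurable ρ) (h0 : ∀ z, 0 ≤ ρ z) (hG : Integrable (g ρ Q 1) P) :
    ContinuousOn (Gam ρ P Q) (Ici 0) := by
  intro t ht
  refine tendsto_integral_filter_of_dominated_convergence (fun x => (max 1 (t+1)) * g ρ Q 1 x)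
      (.of_forall fun s => (g_meas hρm s).aestronglyMeasurable) ?_ (hG.const_mul _)
      (.of_forall fun x => gr_cont (secm hρm x) (fun _ => h0 _) t ht)
  filter_upwards [self_mem_nhdsWithin, mem_nhdsWithin_of_mem_nhds (gt_mem_nhds (lt_add_one t))]
    with s hs hs2
  refine .of_forall fun x => ?_
  rw [Real.norm_eq_abs, abs_of_nonneg (g_nonneg hρm h0 hs x)]
  refine (gr_le_max (secm hρm x) (fun _ => h0 _) hs).trans ?_
  exact mul_le_mul_of_nonneg_right (max_le_max_left _ (le_of_lt hs2))
    (g_nonneg hρm h0 zero_le_one x)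

lemma Gam_diff (hρm : Measurable ρ) (h0 : ∀ z, 0 ≤ ρ z) (hG : Integrable (g ρ Q 1) P) (t : ℝ)
    (ht : 0 < t) : DifferentiableAt ℝ (Gam ρ P Q) t := by
  have hF' : AEStronglyMeasurable (fun x => -((∫ y, (-ρ (x, y)) * Real.exp (t * (-ρ (x, y))) ∂Q)
      / Zr Q (fun y => ρ (x, y)) t)) P := by
    have m1 : StronglyMeasurable fun x => ∫ y, (-ρ (x, y)) * Real.exp (t * (-ρ (x, y))) ∂Q :=
      StronglyMeasurable.integral_prod_right
        (f := fun x y => (-ρ (x, y)) * Real.exp (t * (-ρ (x, y))))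
        (Measurable.stronglyMeasurable (by fun_prop))
    have m2 : StronglyMeasurable fun x => ∫ y, Real.exp (-(t * ρ (x, y))) ∂Q :=
      StronglyMeasurable.integral_prod_right (f := fun x y => Real.exp (-(t * ρ (x, y))))
        (Measurable.stronglyMeasurable (by fun_prop))
    exact (m1.measurable.div m2.measurable).neg.aestronglyMeasurable
  have := hasDerivAt_integral_of_dominated_loc_of_lip (μ := P) (F := fun t x => g ρ Q t x)
    (x₀ := t) (s := Metric.ball t (t/2)) (Metric.ball_mem_nhds t (by linarith))
    (bound := fun x => max 1 (2*t) / (t/2) * g ρ Q 1 x)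
    (.of_forall fun s => (g_meas hρm s).aestronglyMeasurable) (g_int hρm h0 hG ht.le) hF'
    (.of_forall fun x => ?_) (hG.const_mul _)
    (.of_forall fun x => gr_hasDeriv (secm hρm x) (fun _ => h0 _) ht)
  · exact this.2.differentiableAt
  · have hb : ∀ u ∈ Metric.ball t (t/2), t/2 ≤ u ∧ u ≤ 2*t := by
      intro u hu
      rw [Metric.mem_ball, Real.dist_eq, abs_lt] at hu
      constructor <;> linarith [hu.1, hu.2]
    have hg1 : 0 ≤ g ρ Q 1 x := g_nonneg hρm h0 zero_le_one x
    have key : ∀ u ∈ Metric.ball t (t/2), ∀ v ∈ Metric.ball t (t/2), u ≤ v →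
        |g ρ Q v x - g ρ Q u x| ≤ (max 1 (2*t) / (t/2) * g ρ Q 1 x) * |v - u| := by
      intro u hu v hv huv
      refine (gr_lip (secm hρm x) (fun _ => h0 _) (a := t/2) (by linarith) (hb u hu).1 huv).trans ?_
      refine mul_le_mul_of_nonneg_right ?_ (abs_nonneg _)
      refine mul_le_mul_of_nonneg_right ?_ hg1
      exact div_le_div_of_nonneg_right (max_le_max_left _ (hb v hv).2) (by linarith)
    refine LipschitzOnWith.of_dist_le_mul fun u hu v hv => ?_
    have hb0 : 0 ≤ max 1 (2*t) / (t/2) * g ρ Q 1 x :=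
      mul_nonneg (div_nonneg (le_trans zero_le_one (le_max_left _ _)) (by linarith)) hg1
    rw [Real.dist_eq, Real.dist_eq, Real.coe_nnabs, abs_of_nonneg hb0]
    rcases le_total u v with h | h
    · rw [abs_sub_comm, abs_sub_comm u v]; exact key u hu v hv h
    · exact key v hv u hu h

lemma rhoQ_nonneg (hρm : Measurable ρ) (h0 : ∀ z, 0 ≤ ρ z) (x : S) : 0 ≤ rhoQ ρ Q x :=
  ess_nonneg (secm hρm x) fun _ => h0 _

lemma g_ge (hρm : Measurable ρ) (h0 : ∀ z, 0 ≤ ρ z) {t : ℝ} (ht : 0 ≤ t) (x : S) :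
    t * rhoQ ρ Q x ≤ g ρ Q t x := gr_ge (secm hρm x) (fun _ => h0 _) ht

lemma rhoQ_int (hρm : Measurable ρ) (h0 : ∀ z, 0 ≤ ρ z) (hG : Integrable (g ρ Q 1) P) :
    Integrable (rhoQ ρ Q) P := by
  refine hG.mono' (rhoQ_meas hρm h0).aestronglyMeasurable (.of_forall fun x => ?_)
  rw [Real.norm_eq_abs, abs_of_nonneg (rhoQ_nonneg hρm h0 x)]
  simpa using g_ge (Q := Q) hρm h0 zero_le_one x

lemma Gam_ge (hρm : Measurable ρ) (h0 : ∀ z, 0 ≤ ρ z) (hG : Integrable (g ρ Q 1) P) {t : ℝ}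
    (ht : 0 ≤ t) : t * ∫ x, rhoQ ρ Q x ∂P ≤ Gam ρ P Q t := by
  unfold Gam
  rw [← integral_const_mul]
  exact integral_mono ((rhoQ_int hρm h0 hG).const_mul _) (g_int hρm h0 hG ht) fun x =>
    g_ge hρm h0 ht x

lemma Gam_div_tendsto (hρm : Measurable ρ) (h0 : ∀ z, 0 ≤ ρ z) (hG : Integrable (g ρ Q 1) P) :
    Tendsto (fun n : ℕ => Gam ρ P Q n / n) atTop (𝓝 (∫ x, rhoQ ρ Q x ∂P)) := by
  have e : ∀ n : ℕ, Gam ρ P Q n / n = ∫ x, g ρ Q n x / n ∂P := fun n => by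
    rw [integral_div]; rfl
  simp_rw [e]
  refine tendsto_integral_filter_of_dominated_convergence (fun x => g ρ Q 1 x)
    (.of_forall fun n => ((g_meas hρm n).div_const _).aestronglyMeasurable) ?_ hG
    (.of_forall fun x => gr_div_tendsto (secm hρm x) fun y => h0 _)
  filter_upwards [eventually_ge_atTop 1] with n hn
  have hn' : (1:ℝ) ≤ n := by exact_mod_cast hn
  refine .of_forall fun x => ?_
  rw [Real.norm_eq_abs, abs_of_nonneg (div_nonneg (g_nonneg hρm h0 (by positivity) x) (by positivity)),
    div_le_iff₀ (by linarith), mul_comm]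
  have := gr_ratio (Q := Q) (secm hρm x) (fun _ => h0 _) one_pos hn'
  rw [div_one] at this
  exact this

lemma kx_tendsto (hρm : Measurable ρ) (h0 : ∀ z, 0 ≤ ρ z) (hG : Integrable (g ρ Q 1) P) :
    Tendsto (fun n : ℕ => ENNReal.ofReal (Gam ρ P Q n - n * ∫ x, rhoQ ρ Q x ∂P)) atTop
      (𝓝 (∫⁻ x, kx ρ Q x ∂P)) := by
  have e : ∀ n : ℕ, ENNReal.ofReal (Gam ρ P Q n - n * ∫ x, rhoQ ρ Q x ∂P)
      = ∫⁻ x, ENNReal.ofReal (g ρ Q n x - n * rhoQ ρ Q x) ∂P := fun n => by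
    rw [← ofReal_integral_eq_lintegral_ofReal, integral_sub, integral_const_mul]
    · rfl
    · exact g_int hρm h0 hG (by positivity)
    · exact (rhoQ_int hρm h0 hG).const_mul _
    · exact (g_int hρm h0 hG (by positivity)).sub ((rhoQ_int hρm h0 hG).const_mul _)
    · exact .of_forall fun x => sub_nonneg.2 (g_ge hρm h0 (by positivity) x)
  simp_rw [e]
  refine lintegral_tendsto_of_tendsto_of_monotone
    (fun n => ((g_meas hρm n).sub ((rhoQ_meas hρm h0).const_mul _)).ennreal_ofReal.aemeasurable)
    (.of_forall fun x a b hab => ENNReal.ofReal_le_ofReal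
      (gr_shift_mono (secm hρm x) (fun _ => h0 _) (by positivity) (by exact_mod_cast hab)))
    (.of_forall fun x => gr_shift_tendsto (secm hρm x) fun y => h0 _)

end Joint
end GAEP

namespace GAEP

section Rate
variable {S T : Type*} [MeasurableSpace S] [MeasurableSpace T] {P : Measure S} {Q : Measure T}
  [IsProbabilityMeasure P] [IsProbabilityMeasure Q] {ρ : S × T → ℝ}

/-- tilted density -/
def dens (ρ : S × T → ℝ) (Q : Measure T) (t : ℝ) (z : S × T) : ℝ :=
  Real.exp (g ρ Q t z.1 - t * ρ z)

lemma dens_nn (t : ℝ) (z : S × T) : 0 ≤ dens ρ Q t z := (Real.exp_pos _).le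

lemma dens_meas (hρm : Measurable ρ) (t : ℝ) : Measurable (dens ρ Q t) :=
  (((g_meas hρm t).comp measurable_fst).sub (hρm.const_mul t)).exp

lemma dens_lint (hρm : Measurable ρ) (h0 : ∀ z, 0 ≤ ρ z) {t : ℝ} (ht : 0 ≤ t) (x : S) :
    ∫⁻ y, ENNReal.ofReal (dens ρ Q t (x, y)) ∂Q = 1 := by
  have e : ∀ y, dens ρ Q t (x, y) = Real.exp (g ρ Q t x) * Real.exp (-(t * ρ (x, y))) := by
    intro y; rw [← Real.exp_add]; rfl
  simp_rw [e]
  rw [← ofReal_integral_eq_lintegral_ofReal]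
  · rw [integral_const_mul]
    have h1 : ∫ y, Real.exp (-(t * ρ (x, y))) ∂Q = Real.exp (-g ρ Q t x) :=
      (exp_neg_gr (secm hρm x) (fun _ => h0 _) ht).symm
    rw [h1, ← Real.exp_add]
    simp
  · exact (exp_int (secm hρm x) (fun _ => h0 _) ht).const_mul _
  · exact .of_forall fun y => by positivity

/-- Consequences of finiteness of the rate function. -/
lemma rate_upper (hρm : Measurable ρ) (h0 : ∀ z, 0 ≤ ρ z) {D : ℝ} (hR : Rrate ρ P Q D ≠ ⊤) :
    Integrable (g ρ Q 1) P ∧ ∃ H : ℝ, ∀ t, 0 ≤ t → Gam ρ P Q t ≤ t * D + H := by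
  have : ∃ W ∈ distSet ρ P D, relEnt W (P.prod Q) ≠ ⊤ := by
    by_contra h
    push Not at h
    exact hR (by simpa [Rrate] using h)
  obtain ⟨W, ⟨hW, hfst, hD⟩, hH⟩ := this
  have hac : W ≪ P.prod Q ∧ Integrable (llr W (P.prod Q)) W := by
    by_contra h
    exact hH (by simp [relEnt, h])
  obtain ⟨hac, hIntgr⟩ := hac
  have hlt : ∫⁻ z, ENNReal.ofReal (ρ z) ∂W ≠ ⊤ := by
    intro h
    rw [h] at hD
    simp at hD
  have hρi : Integrable ρ W := by
    refine ⟨hρm.aestronglyMeasurable, ?_⟩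
    rw [hasFiniteIntegral_iff_ofReal (.of_forall h0)]
    exact lt_top_iff_ne_top.2 hlt
  have hρD : ∫ z, ρ z ∂W ≤ D := by
    rw [integral_eq_lintegral_of_nonneg_ae (.of_forall h0) hρm.aestronglyMeasurable]
    have h1 := ENNReal.ofReal_toReal hlt
    rw [← h1] at hD
    have : ((∫⁻ z, ENNReal.ofReal (ρ z) ∂W).toReal : EReal) ≤ (D : EReal) := by
      simpa [EReal.coe_ennreal_ofReal] using hD
    exact_mod_cast this
  set ν := P.prod Q with hν
  have key : ∀ t, 0 ≤ t → Integrable (g ρ Q t) P ∧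
      Gam ρ P Q t ≤ t * D + ∫ z, llr W ν z ∂W := by
    intro t ht
    have hq : ∫⁻ z, ENNReal.ofReal (dens ρ Q t z) * ν.rnDeriv W z ∂W ≤ 1 := by
      calc ∫⁻ z, ENNReal.ofReal (dens ρ Q t z) * ν.rnDeriv W z ∂W
          = ∫⁻ z, ENNReal.ofReal (dens ρ Q t z) ∂(W.withDensity (ν.rnDeriv W)) := by
            rw [lintegral_withDensity_eq_lintegral_mul _ (Measure.measurable_rnDeriv _ _)
              (dens_meas hρm t).ennreal_ofReal]
            simp [mul_comm]
        _ ≤ ∫⁻ z, ENNReal.ofReal (dens ρ Q t z) ∂ν :=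
            lintegral_mono' (Measure.withDensity_rnDeriv_le _ _) le_rfl
        _ = 1 := by
            rw [hν, lintegral_prod _ (dens_meas hρm t).ennreal_ofReal.aemeasurable]
            simp [dens_lint hρm h0 ht]
    set F : S × T → ℝ := fun z => dens ρ Q t z * (ν.rnDeriv W z).toReal with hF
    have hF0 : ∀ z, 0 ≤ F z := fun z => mul_nonneg (Real.exp_pos _).le ENNReal.toReal_nonneg
    have hFm : Measurable F := (dens_meas hρm t).mul (Measure.measurable_rnDeriv _ _).ennreal_toReal
    have hFl : ∫⁻ z, ENNReal.ofReal (F z) ∂W ≤ 1 := by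
      refine (lintegral_mono fun z => ?_).trans hq
      simp only [hF]
      rw [ENNReal.ofReal_mul (dens_nn t z)]
      gcongr
      exact ENNReal.ofReal_toReal_le
    have hFi : Integrable F W := by
      refine ⟨hFm.aestronglyMeasurable, ?_⟩
      rw [hasFiniteIntegral_iff_ofReal (.of_forall hF0)]
      exact hFl.trans_lt ENNReal.one_lt_top
    have hF1 : ∫ z, F z ∂W ≤ 1 := by
      rw [integral_eq_lintegral_of_nonneg_ae (.of_forall hF0) hFm.aestronglyMeasurable]
      exact ENNReal.toReal_le_of_le_ofReal zero_le_one (by simpa using hFl)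
    have hle : ∀ᵐ z ∂W, g ρ Q t z.1 ≤ t * ρ z + llr W ν z + F z - 1 := by
      filter_upwards [exp_neg_llr hac] with z hz
      have : F z = Real.exp (g ρ Q t z.1 - t * ρ z - llr W ν z) := by
        simp only [hF]
        rw [← hz, dens, ← Real.exp_add]; congr 1
      rw [this]
      have := Real.add_one_le_exp (g ρ Q t z.1 - t * ρ z - llr W ν z)
      linarith
    have hRi : Integrable (fun z => t * ρ z + llr W ν z + F z - 1) W :=
      (((hρi.const_mul t).add hIntgr).add hFi).sub (integrable_const _)
    have hgi : Integrable (fun z : S × T => g ρ Q t z.1) W := by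
      refine hRi.mono' ((g_meas hρm t).comp measurable_fst).aestronglyMeasurable ?_
      filter_upwards [hle] with z hz
      rwa [Real.norm_eq_abs, abs_of_nonneg (g_nonneg hρm h0 ht _)]
    have hgP : Integrable (g ρ Q t) P := by
      rw [← hfst]
      exact (integrable_map_measure (g_meas hρm t).aestronglyMeasurable
        measurable_fst.aemeasurable).2 hgi
    refine ⟨hgP, ?_⟩
    have h1 : Gam ρ P Q t = ∫ z, g ρ Q t z.1 ∂W := by
      rw [Gam]
      conv_lhs => rw [← hfst]
      exact integral_map measurable_fst.aemeasurable (g_meas hρm t).aestronglyMeasurable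
    rw [h1]
    refine (integral_mono_ae hgi hRi hle).trans ?_
    have i1 : Integrable (fun z => t * ρ z + llr W ν z) W := (hρi.const_mul t).add hIntgr
    have i2 : Integrable (fun z => t * ρ z + llr W ν z + F z) W := i1.add hFi
    rw [integral_sub i2 (integrable_const _),
      integral_add i1 hFi, integral_add (hρi.const_mul t) hIntgr,
      integral_const_mul]
    have := mul_le_mul_of_nonneg_left hρD ht
    simp
    linarith
  exact ⟨(key 1 zero_le_one).1, _, fun t ht => (key t ht).2⟩

lemma rate_nec (hρm : Measurable ρ) (h0 : ∀ z, 0 ≤ ρ z) {D : ℝ} (hR : Rrate ρ P Q D ≠ ⊤) :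
    Integrable (g ρ Q 1) P ∧ (∫ x, rhoQ ρ Q x ∂P) ≤ D ∧
      (D = (∫ x, rhoQ ρ Q x ∂P) → ∫⁻ x, kx ρ Q x ∂P ≠ ⊤) := by
  obtain ⟨hG, H, hH⟩ := rate_upper hρm h0 hR
  refine ⟨hG, ?_, ?_⟩
  · have h1 : Tendsto (fun n : ℕ => D + H / n) atTop (𝓝 (D + 0)) :=
      tendsto_const_nhds.add (tendsto_const_div_atTop_nhds_zero_nat H)
    rw [add_zero] at h1
    refine le_of_tendsto_of_tendsto (Gam_div_tendsto hρm h0 hG) h1 ?_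
    filter_upwards [eventually_gt_atTop 0] with n hn
    have hn' : (0:ℝ) < n := by exact_mod_cast hn
    rw [div_le_iff₀ hn']
    refine (hH n hn'.le).trans (le_of_eq ?_)
    field_simp
  · intro hD
    have : ∫⁻ x, kx ρ Q x ∂P ≤ ENNReal.ofReal H := by
      refine le_of_tendsto (kx_tendsto hρm h0 hG) (.of_forall fun n => ?_)
      refine ENNReal.ofReal_le_ofReal ?_
      have := hH n (by positivity)
      rw [← hD]; linarith
    exact ne_top_of_le_ne_top ENNReal.ofReal_ne_top this

lemma rate_of_dens {D : ℝ} {p : S × T → ℝ≥0∞} (hp : Measurable p)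
    (hp1 : ∀ᵐ x ∂P, ∫⁻ y, p (x, y) ∂Q = 1)
    (hIntgr : ((P.prod Q).withDensity p).map Prod.fst = P →
      Integrable (fun z => Real.log (p z).toReal) ((P.prod Q).withDensity p))
    (hD0 : 0 ≤ D) (hD : ((P.prod Q).withDensity p).map Prod.fst = P →
      ∫⁻ z, ENNReal.ofReal (ρ z) ∂((P.prod Q).withDensity p) ≤ ENNReal.ofReal D) :
    Rrate ρ P Q D ≠ ⊤ := by
  set W := (P.prod Q).withDensity p with hW
  have hfst : W.map Prod.fst = P := by
    ext A hA
    rw [Measure.map_apply measurable_fst hA, hW, withDensity_apply _ (measurable_fst hA),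
      ← lintegral_indicator (measurable_fst hA), lintegral_prod _
        (hp.indicator (measurable_fst hA)).aemeasurable]
    have : ∀ᵐ x ∂P, ∫⁻ y, (Prod.fst ⁻¹' A).indicator p (x, y) ∂Q = A.indicator 1 x := by
      filter_upwards [hp1] with x hx
      by_cases hxA : x ∈ A
      · simp only [indicator, mem_preimage, hxA, if_true]; simpa using hx
      · simp [indicator, hxA]
    rw [lintegral_congr_ae this, lintegral_indicator_one hA]
  have hprob : IsProbabilityMeasure W := by
    refine ⟨?_⟩
    have : W univ = (W.map Prod.fst) univ := by
      rw [Measure.map_apply measurable_fst MeasurableSet.univ]; simp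
    rw [this, hfst]; simp
  have hac : W ≪ P.prod Q := withDensity_absolutelyContinuous _ _
  have hllr : (fun z => Real.log (p z).toReal) =ᵐ[W] llr W (P.prod Q) := by
    refine hac.ae_le ?_
    filter_upwards [Measure.rnDeriv_withDensity (P.prod Q) hp] with z hz
    rw [llr, hW, hz]
  have hWD : W ∈ distSet ρ P D := by
    refine ⟨hprob, hfst, ?_⟩
    have := EReal.coe_ennreal_le_coe_ennreal_iff.2 (hD hfst)
    rwa [EReal.coe_ennreal_ofReal, max_eq_left hD0] at this
  have hle : Rrate ρ P Q D ≤ relEnt W (P.prod Q) := iInf₂_le W hWD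
  refine ne_top_of_le_ne_top ?_ hle
  rw [relEnt, if_pos ⟨hac, (hIntgr hfst).congr hllr⟩]
  exact ENNReal.ofReal_ne_top

lemma rate_suff (hρm : Measurable ρ) (h0 : ∀ z, 0 ≤ ρ z) {D : ℝ}
    (hG : Integrable (g ρ Q 1) P) (hD : (∫ x, rhoQ ρ Q x ∂P) < D) : Rrate ρ P Q D ≠ ⊤ := by
  obtain ⟨N, hN1, hN2⟩ := (((Gam_div_tendsto hρm h0 hG).eventually (gt_mem_nhds hD)).and
    (eventually_gt_atTop 0)).exists
  have hN0 : (0:ℝ) < N := by exact_mod_cast hN2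
  set t : ℝ := (N:ℝ) with ht
  have hD0 : 0 ≤ D := (integral_nonneg fun x => rhoQ_nonneg hρm h0 x).trans hD.le
  have hgi := g_int hρm h0 hG hN0.le
  set p : S × T → ℝ≥0∞ := fun z => ENNReal.ofReal (dens ρ Q t z) with hpdef
  have hp : Measurable p := (dens_meas hρm t).ennreal_ofReal
  have hmain : ((P.prod Q).withDensity p).map Prod.fst = P →
      ∫⁻ z, ENNReal.ofReal (t * ρ z) ∂((P.prod Q).withDensity p) ≤ ENNReal.ofReal (Gam ρ P Q t) := by
    intro hfst
    have hp1 : ∫⁻ z, p z ∂(P.prod Q) = 1 := by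
      rw [lintegral_prod _ hp.aemeasurable]
      simp [hpdef, dens_lint hρm h0 hN0.le]
    have e1 : ENNReal.ofReal (Gam ρ P Q t)
        = ∫⁻ z, p z * ENNReal.ofReal (g ρ Q t z.1) ∂(P.prod Q) := by
      rw [Gam, ofReal_integral_eq_lintegral_ofReal hgi
        (.of_forall fun x => g_nonneg hρm h0 hN0.le x)]
      conv_lhs => rw [← hfst]
      rw [lintegral_map (g_meas hρm t).ennreal_ofReal measurable_fst,
        lintegral_withDensity_eq_lintegral_mul _ hp
          (g := fun z : S × T => ENNReal.ofReal (g ρ Q t z.1))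
          ((g_meas hρm t).comp measurable_fst).ennreal_ofReal]
      rfl
    rw [lintegral_withDensity_eq_lintegral_mul _ hp (hρm.const_mul t).ennreal_ofReal]
    refine (ENNReal.add_le_add_iff_right ENNReal.one_ne_top).1 ?_
    calc ∫⁻ z, (p * fun z => ENNReal.ofReal (t * ρ z)) z ∂(P.prod Q) + 1
        = ∫⁻ z, (p z * ENNReal.ofReal (t * ρ z) + p z) ∂(P.prod Q) := by
          rw [lintegral_add_right _ hp, hp1]; rfl
      _ ≤ ∫⁻ z, (p z * ENNReal.ofReal (g ρ Q t z.1) + 1) ∂(P.prod Q) := by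
          refine lintegral_mono fun z => ?_
          have hg := g_nonneg (Q := Q) hρm h0 hN0.le z.1
          have hr := mul_nonneg hN0.le (h0 z)
          simp only [hpdef]
          have hn := dens_nn (ρ := ρ) (Q := Q) t z
          rw [← ENNReal.ofReal_mul hn, ← ENNReal.ofReal_mul hn,
            ← ENNReal.ofReal_one, ← ENNReal.ofReal_add (mul_nonneg hn hr) hn,
            ← ENNReal.ofReal_add (mul_nonneg hn hg) zero_le_one]
          refine ENNReal.ofReal_le_ofReal ?_
          unfold dens
          set v := g ρ Q t z.1 - t * ρ z with hv
          have h1 := Real.add_one_le_exp (-v)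
          have h2 := Real.exp_pos v
          have h3 : Real.exp v * Real.exp (-v) = 1 := by rw [← Real.exp_add]; simp
          have h4 := mul_le_mul_of_nonneg_left h1 h2.le
          have h5 : t * ρ z = g ρ Q t z.1 - v := by rw [hv]; ring
          rw [h5]
          nlinarith
      _ = ENNReal.ofReal (Gam ρ P Q t) + 1 := by
          rw [lintegral_add_right _ measurable_const, e1]; simp
  refine rate_of_dens hp (.of_forall fun x => dens_lint hρm h0 hN0.le x) ?_ hD0 ?_
  · intro hfst
    have e : (fun z => Real.log (p z).toReal) = fun z => g ρ Q t z.1 - t * ρ z := by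
      funext z
      simp only [hpdef]
      rw [ENNReal.toReal_ofReal (dens_nn t z), dens, Real.log_exp]
    rw [e]
    refine Integrable.sub ?_ ?_
    · rw [← hfst] at hgi
      exact (integrable_map_measure (g_meas hρm t).aestronglyMeasurable
        measurable_fst.aemeasurable).1 hgi
    · refine ⟨(hρm.const_mul t).aestronglyMeasurable, ?_⟩
      rw [hasFiniteIntegral_iff_ofReal (.of_forall fun z => mul_nonneg hN0.le (h0 z))]
      exact (hmain hfst).trans_lt ENNReal.ofReal_lt_top
  · intro hfst
    have h1 := hmain hfst
    have e : ∀ z, ENNReal.ofReal (t * ρ z) = ENNReal.ofReal t * ENNReal.ofReal (ρ z) := fun z =>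
      ENNReal.ofReal_mul hN0.le
    simp_rw [e] at h1
    rw [lintegral_const_mul _ hρm.ennreal_ofReal] at h1
    have h2 : ENNReal.ofReal (Gam ρ P Q t) ≤ ENNReal.ofReal t * ENNReal.ofReal D := by
      rw [← ENNReal.ofReal_mul hN0.le]
      refine ENNReal.ofReal_le_ofReal ?_
      rw [div_lt_iff₀ hN0] at hN1
      linarith
    exact (ENNReal.mul_le_mul_iff_right (by simpa using hN0) ENNReal.ofReal_ne_top).1 (h1.trans h2)

lemma rate_suff' (hρm : Measurable ρ) (h0 : ∀ z, 0 ≤ ρ z)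
    (hG : Integrable (g ρ Q 1) P) (hK : ∫⁻ x, kx ρ Q x ∂P ≠ ⊤) :
    Rrate ρ P Q (∫ x, rhoQ ρ Q x ∂P) ≠ ⊤ := by
  have hD0 : 0 ≤ ∫ x, rhoQ ρ Q x ∂P := integral_nonneg fun x => rhoQ_nonneg hρm h0 x
  have hri := rhoQ_int hρm h0 hG
  set A : Set (S × T) := {z | ρ z = rhoQ ρ Q z.1} with hA
  have hAm : MeasurableSet A :=
    measurableSet_eq_fun hρm ((rhoQ_meas hρm h0).comp measurable_fst)
  set q : S → ℝ≥0∞ := fun x => Q {y | ρ (x, y) = rhoQ ρ Q x} with hq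
  have hqm : Measurable q := measurable_measure_prodMk_left hAm
  set p : S × T → ℝ≥0∞ := A.indicator fun z => (q z.1)⁻¹ with hpdef
  have hp : Measurable p := (hqm.comp measurable_fst).inv.indicator hAm
  have hWA : ∀ᵐ z ∂((P.prod Q).withDensity p), z ∈ A := by
    rw [ae_withDensity_iff hp]
    refine .of_forall fun z hz => ?_
    by_contra h
    exact hz (by simp [hpdef, h])
  have hkae : ∀ᵐ x ∂P, q x ≠ 0 := by
    filter_upwards [ae_lt_top (kx_meas hρm h0) hK] with x hx h
    have : kx ρ Q x = ⊤ := by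
      unfold kx negLog
      rw [if_pos]; exact h
    rw [this] at hx; simp at hx
  refine rate_of_dens hp ?_ ?_ hD0 ?_
  · filter_upwards [hkae] with x hx
    have : ∀ y, p (x, y) = ({y | ρ (x, y) = rhoQ ρ Q x} : Set T).indicator (fun _ => (q x)⁻¹) y := by
      intro y; simp only [hpdef, indicator]; rfl
    simp_rw [this]
    rw [lintegral_indicator_const (measurableSet_eq_fun (secm hρm x) measurable_const)]
    exact ENNReal.inv_mul_cancel hx (measure_ne_top _ _)
  · intro hfst
    have hki : Integrable (fun x => (kx ρ Q x).toReal) P :=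
      integrable_toReal_of_lintegral_ne_top (kx_meas hρm h0).aemeasurable hK
    rw [← hfst] at hki
    have hki := (integrable_map_measure (kx_meas hρm h0).ennreal_toReal.aestronglyMeasurable
        measurable_fst.aemeasurable).1 hki
    refine hki.congr ?_
    have hk2 : ∀ᵐ z ∂((P.prod Q).withDensity p), q z.1 ≠ 0 := by
      rw [← hfst] at hkae
      exact ae_of_ae_map measurable_fst.aemeasurable hkae
    filter_upwards [hWA, hk2] with z hz hqz
    have : p z = (q z.1)⁻¹ := by simp [hpdef, hz]
    rw [this, ENNReal.toReal_inv, Real.log_inv]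
    simp only [Function.comp]
    have e : kx ρ Q z.1 = ENNReal.ofReal (-Real.log (q z.1).toReal) := by
      unfold kx negLog
      rw [if_neg]; exact hqz
    rw [e, ENNReal.toReal_ofReal]
    have : (q z.1).toReal ≤ 1 := by
      have := ENNReal.toReal_mono ENNReal.one_ne_top (prob_le_one (μ := Q) (s := {y | ρ (z.1, y) = rhoQ ρ Q z.1}))
      simpa using this
    have := Real.log_nonpos ENNReal.toReal_nonneg this
    linarith
  · intro hfst
    rw [ofReal_integral_eq_lintegral_ofReal hri (.of_forall fun x => rhoQ_nonneg hρm h0 x)]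
    conv_rhs => rw [← hfst]
    rw [lintegral_map (rhoQ_meas hρm h0).ennreal_ofReal measurable_fst]
    refine le_of_eq (lintegral_congr_ae ?_)
    filter_upwards [hWA] with z hz
    rw [show ρ z = rhoQ ρ Q z.1 from hz]

lemma rate_set (hρm : Measurable ρ) (h0 : ∀ z, 0 ≤ ρ z) (hG : Integrable (g ρ Q 1) P) :
    {D' : ℝ | Rrate ρ P Q D' ≠ ⊤}.Nonempty ∧
      sInf {D' : ℝ | Rrate ρ P Q D' ≠ ⊤} = ∫ x, rhoQ ρ Q x ∂P := by
  have hne : {D' : ℝ | Rrate ρ P Q D' ≠ ⊤}.Nonempty :=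
    ⟨_, rate_suff hρm h0 hG (lt_add_one _)⟩
  refine ⟨hne, ?_⟩
  have hlb : ∀ D' ∈ {D' : ℝ | Rrate ρ P Q D' ≠ ⊤}, (∫ x, rhoQ ρ Q x ∂P) ≤ D' :=
    fun D' h => (rate_nec hρm h0 h).2.1
  refine le_antisymm (le_of_forall_gt_imp_ge_of_dense fun a ha => ?_) (le_csInf hne hlb)
  exact csInf_le ⟨_, hlb⟩ (rate_suff hρm h0 hG ha)

end Rate
end GAEP

namespace GAEP

section Ln
variable {S T : Type*} [MeasurableSpace S] [MeasurableSpace T] {P : Measure S} {Q : Measure T}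
  [IsProbabilityMeasure P] [IsProbabilityMeasure Q] {ρ : S × T → ℝ}

/-- probability of the distortion ball -/
def qn (ρ : S × T → ℝ) (Q : Measure T) (D : ℝ) (n : ℕ) (x : ℕ → S) : ℝ :=
  ((Measure.pi fun _ : Fin n => Q) {y | rhoFin ρ n (fun k => x k) y ≤ D}).toReal

/-- total distortion -/
def sig (ρ : S × T → ℝ) (n : ℕ) (x : ℕ → S) (y : Fin n → T) : ℝ := ∑ k : Fin n, ρ (x k, y k)

lemma sig_meas (hρm : Measurable ρ) (n : ℕ) (x : ℕ → S) : Measurable (sig ρ n x) :=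
  Finset.measurable_fun_sum _ fun k _ => (secm hρm (x k)).comp (measurable_pi_apply k)

lemma sig_nonneg (h0 : ∀ z, 0 ≤ ρ z) (n : ℕ) (x : ℕ → S) (y : Fin n → T) : 0 ≤ sig ρ n x y :=
  Finset.sum_nonneg fun k _ => h0 _

lemma ball_iff {n : ℕ} (hn : 0 < n) (D : ℝ) (x : ℕ → S) (y : Fin n → T) :
    rhoFin ρ n (fun k => x k) y ≤ D ↔ sig ρ n x y ≤ n * D := by
  have hn' : (0:ℝ) < n := by exact_mod_cast hn
  unfold rhoFin sig
  rw [inv_mul_le_iff₀ hn']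

lemma Ln_ge {n : ℕ} (hn : 0 < n) {D : ℝ} {x : ℕ → S} {a : ℝ}
    (h : qn ρ Q D n x ≤ Real.exp (-(n * a))) : ENNReal.ofReal a ≤ LnIID ρ Q D n x := by
  have hn' : (0:ℝ) < n := by exact_mod_cast hn
  unfold LnIID negLog
  split_ifs with h0
  · rw [ENNReal.mul_top (by simp)]; exact le_top
  · have hq : 0 < qn ρ Q D n x := ENNReal.toReal_pos h0 (measure_ne_top _ _)
    have h1 : (n:ℝ) * a ≤ -Real.log (qn ρ Q D n x) := by
      have := (Real.log_le_iff_le_exp hq).2 h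
      linarith
    rw [mul_comm, ← div_eq_mul_inv, ENNReal.le_div_iff_mul_le (Or.inl (by simpa using hn.ne'))
      (Or.inl (by simp)), mul_comm, ← ENNReal.ofReal_natCast, ← ENNReal.ofReal_mul hn'.le]
    exact ENNReal.ofReal_le_ofReal h1

lemma Ln_le {n : ℕ} (hn : 0 < n) {D : ℝ} {x : ℕ → S} {a : ℝ}
    (h : Real.exp (-(n * a)) ≤ qn ρ Q D n x) : LnIID ρ Q D n x ≤ ENNReal.ofReal a := by
  have hn' : (0:ℝ) < n := by exact_mod_cast hn
  have hq : 0 < qn ρ Q D n x := (Real.exp_pos _).trans_le h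
  unfold LnIID negLog
  rw [if_neg]
  · have h1 : -Real.log (qn ρ Q D n x) ≤ (n:ℝ) * a := by
      have := (Real.le_log_iff_exp_le hq).2 h
      linarith
    rw [ENNReal.inv_mul_le_iff (by simpa using hn.ne') (by simp), ← ENNReal.ofReal_natCast,
      ← ENNReal.ofReal_mul hn'.le]
    exact ENNReal.ofReal_le_ofReal h1
  · intro h0
    rw [qn, h0] at hq
    simp at hq

lemma sig_exp_int (hρm : Measurable ρ) (h0 : ∀ z, 0 ≤ ρ z) (n : ℕ) (x : ℕ → S) {t : ℝ}
    (ht : 0 ≤ t) : Integrable (fun y => Real.exp (-(t * sig ρ n x y)))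
      (Measure.pi fun _ : Fin n => Q) :=
  exp_int (sig_meas hρm n x) (sig_nonneg h0 n x) ht

lemma sig_exp (hρm : Measurable ρ) (h0 : ∀ z, 0 ≤ ρ z) (n : ℕ) (x : ℕ → S) {t : ℝ}
    (ht : 0 ≤ t) : ∫ y, Real.exp (-(t * sig ρ n x y)) ∂(Measure.pi fun _ : Fin n => Q)
      = Real.exp (-∑ k ∈ Finset.range n, g ρ Q t (x k)) := by
  have e : ∀ y : Fin n → T, Real.exp (-(t * sig ρ n x y))
      = ∏ k : Fin n, Real.exp (-(t * ρ (x k, y k))) := by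
    intro y
    rw [← Real.exp_sum]
    congr 1
    rw [sig, Finset.mul_sum, Finset.sum_neg_distrib]
  simp_rw [e]
  rw [integral_fintype_prod_eq_prod (f := fun (k : Fin n) y => Real.exp (-(t * ρ (x k, y))))]
  rw [← Finset.sum_neg_distrib, Real.exp_sum, Finset.prod_range]
  refine Finset.prod_congr rfl fun k _ => ?_
  exact (exp_neg_gr (secm hρm (x k)) (fun _ => h0 _) ht).symm

lemma qn_chernoff (hρm : Measurable ρ) (h0 : ∀ z, 0 ≤ ρ z) {n : ℕ} (hn : 0 < n) (x : ℕ → S)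
    {t : ℝ} (ht : 0 ≤ t) (D : ℝ) :
    qn ρ Q D n x ≤ Real.exp (t * (n * D) - ∑ k ∈ Finset.range n, g ρ Q t (x k)) := by
  have hm : MeasurableSet {y | rhoFin ρ n (fun k => x k) y ≤ D} := by
    simp_rw [ball_iff hn]
    exact measurableSet_le (sig_meas hρm n x) measurable_const
  rw [sub_eq_add_neg, Real.exp_add, ← sig_exp hρm h0 n x ht, ← integral_const_mul]
  unfold qn
  rw [← Measure.real, ← integral_indicator_one hm]
  refine integral_mono ((integrable_const _).indicator hm)
    ((sig_exp_int hρm h0 n x ht).const_mul _) fun y => ?_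
  by_cases hy : rhoFin ρ n (fun k => x k) y ≤ D
  · have h1 := (ball_iff hn D x y).1 hy
    have h2 := mul_le_mul_of_nonneg_left h1 ht
    simp only [indicator, mem_ofPred_eq, hy, if_true, Pi.one_apply]
    rw [← Real.exp_add, Real.one_le_exp_iff]
    linarith
  · simp only [indicator, mem_ofPred_eq, hy, if_false]
    positivity

lemma qn_lower (hρm : Measurable ρ) (h0 : ∀ z, 0 ≤ ρ z) {n : ℕ} (hn : 0 < n) (x : ℕ → S)
    {t s s' a D : ℝ} (ht : 0 ≤ t) (hs : 0 ≤ s) (hst : s ≤ t) (hs' : 0 ≤ s') :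
    Real.exp (-∑ k ∈ Finset.range n, g ρ Q t (x k)) ≤
      Real.exp (-(s * (n * D))) * Real.exp (-∑ k ∈ Finset.range n, g ρ Q (t - s) (x k))
      + Real.exp (s' * (n * a)) * Real.exp (-∑ k ∈ Finset.range n, g ρ Q (t + s') (x k))
      + Real.exp (-(t * (n * a))) * qn ρ Q D n x := by
  have hm : MeasurableSet {y | rhoFin ρ n (fun k => x k) y ≤ D} := by
    simp_rw [ball_iff hn]
    exact measurableSet_le (sig_meas hρm n x) measurable_const
  have i1 := (sig_exp_int (Q := Q) hρm h0 n x (sub_nonneg.2 hst)).const_mul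
    (Real.exp (-(s * (n * D))))
  have i2 := (sig_exp_int (Q := Q) hρm h0 n x (add_nonneg ht hs')).const_mul
    (Real.exp (s' * (n * a)))
  have i3 : Integrable (fun y => Real.exp (-(t * (n * a))) *
      ({y | rhoFin ρ n (fun k => x k) y ≤ D} : Set (Fin n → T)).indicator (1 : (Fin n → T) → ℝ) y)
      (Measure.pi fun _ : Fin n => Q) := ((integrable_const _).indicator hm).const_mul _
  have i12 : Integrable (fun y => Real.exp (-(s * (n * D))) * Real.exp (-((t - s) * sig ρ n x y))
      + Real.exp (s' * (n * a)) * Real.exp (-((t + s') * sig ρ n x y)))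
      (Measure.pi fun _ : Fin n => Q) := i1.add i2
  unfold qn
  rw [← Measure.real, ← integral_indicator_one hm, ← sig_exp hρm h0 n x ht,
    ← sig_exp hρm h0 n x (sub_nonneg.2 hst), ← sig_exp hρm h0 n x (add_nonneg ht hs'),
    ← integral_const_mul, ← integral_const_mul, ← integral_const_mul, ← integral_add i1 i2,
    ← integral_add i12 i3]
  refine integral_mono (sig_exp_int hρm h0 n x ht) (i12.add i3) fun y => ?_
  set σ := sig ρ n x y with hσ
  have p1 : 0 ≤ Real.exp (-(s * (n * D))) * Real.exp (-((t - s) * σ)) := by positivity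
  have p2 : 0 ≤ Real.exp (s' * (n * a)) * Real.exp (-((t + s') * σ)) := by positivity
  have p3 : 0 ≤ Real.exp (-(t * (n * a))) * ({y | rhoFin ρ n (fun k => x k) y ≤ D} :
      Set (Fin n → T)).indicator (1 : (Fin n → T) → ℝ) y :=
    mul_nonneg (Real.exp_pos _).le (indicator_nonneg (fun _ _ => zero_le_one) _)
  change Real.exp (-(t * σ)) ≤ Real.exp (-(s * (n * D))) * Real.exp (-((t - s) * σ))
    + Real.exp (s' * (n * a)) * Real.exp (-((t + s') * σ)) + Real.exp (-(t * (n * a))) *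
      ({y | rhoFin ρ n (fun k => x k) y ≤ D} : Set (Fin n → T)).indicator (1 : (Fin n → T) → ℝ) y
  by_cases hy : rhoFin ρ n (fun k => x k) y ≤ D
  · by_cases hy2 : σ < n * a
    · have : Real.exp (-(t * σ)) ≤ Real.exp (s' * (n * a)) * Real.exp (-((t + s') * σ)) := by
        rw [← Real.exp_add, Real.exp_le_exp]
        have := mul_le_mul_of_nonneg_left hy2.le hs'
        linarith
      linarith
    · have : Real.exp (-(t * σ)) ≤ Real.exp (-(t * (n * a))) * ({y | rhoFin ρ n (fun k => x k) y ≤ D} :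
          Set (Fin n → T)).indicator (1 : (Fin n → T) → ℝ) y := by
        simp only [indicator, mem_ofPred_eq, hy, if_true, Pi.one_apply, mul_one]
        rw [Real.exp_le_exp]
        have := mul_le_mul_of_nonneg_left (not_lt.1 hy2) ht
        linarith
      linarith
  · have h1 : n * D < σ := by
      rw [ball_iff hn] at hy; exact not_le.1 hy
    have : Real.exp (-(t * σ)) ≤ Real.exp (-(s * (n * D))) * Real.exp (-((t - s) * σ)) := by
      rw [← Real.exp_add, Real.exp_le_exp]
      have := mul_le_mul_of_nonneg_left h1.le hs
      linarith
    linarith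

lemma exp_quarter {A B n l : ℝ} (h : Real.log 4 ≤ B - A) : Real.exp (-B) ≤ Real.exp (-A) / 4 := by
  have : Real.exp (-A) / 4 = Real.exp (-A - Real.log 4) := by
    rw [Real.exp_sub, Real.exp_log (by norm_num)]
  rw [this, Real.exp_le_exp]; linarith

/-- Upper bound on `L_n` from convergence of averages. -/
lemma Ln_upper (hρm : Measurable ρ) (h0 : ∀ z, 0 ≤ ρ z) (x : ℕ → S)
    {t s s' a D b : ℝ} {Γ : ℝ → ℝ} (ht : 0 ≤ t) (hs : 0 ≤ s) (hst : s ≤ t) (hs' : 0 ≤ s')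
    (c1 : Γ t - Γ (t - s) < s * D) (c2 : s' * a < Γ (t + s') - Γ t) (c3 : Γ t - t * a < b)
    (l1 : Tendsto (fun n : ℕ => (∑ k ∈ Finset.range n, g ρ Q t (x k)) / n) atTop (𝓝 (Γ t)))
    (l2 : Tendsto (fun n : ℕ => (∑ k ∈ Finset.range n, g ρ Q (t - s) (x k)) / n) atTop
      (𝓝 (Γ (t - s))))
    (l3 : Tendsto (fun n : ℕ => (∑ k ∈ Finset.range n, g ρ Q (t + s') (x k)) / n) atTop
      (𝓝 (Γ (t + s')))) :
    ∀ᶠ n in atTop, LnIID ρ Q D n x ≤ ENNReal.ofReal b := by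
  have L4 := tendsto_const_div_atTop_nhds_zero_nat (Real.log 4)
  have L2 := tendsto_const_div_atTop_nhds_zero_nat (Real.log 2)
  have E1 : Tendsto (fun n : ℕ => s * D + (∑ k ∈ Finset.range n, g ρ Q (t - s) (x k)) / n
      - (∑ k ∈ Finset.range n, g ρ Q t (x k)) / n - Real.log 4 / n) atTop
      (𝓝 (s * D + Γ (t - s) - Γ t - 0)) := ((tendsto_const_nhds.add l2).sub l1).sub L4
  have E2 : Tendsto (fun n : ℕ => (∑ k ∈ Finset.range n, g ρ Q (t + s') (x k)) / n - s' * a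
      - (∑ k ∈ Finset.range n, g ρ Q t (x k)) / n - Real.log 4 / n) atTop
      (𝓝 (Γ (t + s') - s' * a - Γ t - 0)) := ((l3.sub tendsto_const_nhds).sub l1).sub L4
  have E3 : Tendsto (fun n : ℕ => (∑ k ∈ Finset.range n, g ρ Q t (x k)) / n - t * a
      + Real.log 2 / n) atTop (𝓝 (Γ t - t * a + 0)) := (l1.sub tendsto_const_nhds).add L2
  filter_upwards [E1.eventually (lt_mem_nhds (a := 0) (by linarith)),
    E2.eventually (lt_mem_nhds (a := 0) (by linarith)),
    E3.eventually (gt_mem_nhds (show Γ t - t * a + 0 < b by linarith)), eventually_gt_atTop 0] with n h1 h2 h3 hn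
  have hn' : (0:ℝ) < n := by exact_mod_cast hn
  refine Ln_le hn ?_
  have hmain := qn_lower (Q := Q) hρm h0 hn x (a := a) (D := D) ht hs hst hs'
  generalize (∑ k ∈ Finset.range n, g ρ Q t (x k)) = A at *
  generalize (∑ k ∈ Finset.range n, g ρ Q (t - s) (x k)) = A1 at *
  generalize (∑ k ∈ Finset.range n, g ρ Q (t + s') (x k)) = A2 at *
  generalize qn ρ Q D n x = q at *
  have h1' : 0 < s * (n * D) + A1 - A - Real.log 4 := by
    have := mul_pos hn' h1
    have e : (n:ℝ) * (s * D + A1 / n - A / n - Real.log 4 / n)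
      = s * (n * D) + A1 - A - Real.log 4 := by field_simp
    linarith
  have h2' : 0 < A2 - s' * (n * a) - A - Real.log 4 := by
    have := mul_pos hn' h2
    have e : (n:ℝ) * (A2 / n - s' * a - A / n - Real.log 4 / n)
      = A2 - s' * (n * a) - A - Real.log 4 := by field_simp
    linarith
  have h3' : A - t * (n * a) + Real.log 2 < n * b := by
    have := mul_lt_mul_of_pos_left h3 hn'
    have e : (n:ℝ) * (A / n - t * a + Real.log 2 / n)
      = A - t * (n * a) + Real.log 2 := by field_simp
    linarith
  have q1 : Real.exp (-(s * (n * D))) * Real.exp (-A1) ≤ Real.exp (-A) / 4 := by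
    rw [← Real.exp_add, ← neg_add]
    exact exp_quarter (n := 0) (l := 0) (by linarith)
  have q2 : Real.exp (s' * (n * a)) * Real.exp (-A2) ≤ Real.exp (-A) / 4 := by
    rw [← Real.exp_add, show s' * (n * a) + -A2 = -(A2 - s' * (n * a)) by ring]
    exact exp_quarter (n := 0) (l := 0) (by linarith)
  have q3 : Real.exp (-A) / 2 ≤ Real.exp (-(t * (n * a))) * q := by linarith
  have q4 : Real.exp (t * (n * a)) * Real.exp (-(t * (n * a))) = 1 := by
    rw [← Real.exp_add]; simp
  have q5 : Real.exp (t * (n * a)) * (Real.exp (-A) / 2) ≤ q := by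
    calc _ ≤ Real.exp (t * (n * a)) * (Real.exp (-(t * (n * a))) * q) :=
          mul_le_mul_of_nonneg_left q3 (Real.exp_pos _).le
      _ = q := by rw [← mul_assoc, q4, one_mul]
  refine le_trans ?_ q5
  have : Real.exp (t * (n * a)) * (Real.exp (-A) / 2) = Real.exp (t * (n * a) - A - Real.log 2) := by
    rw [Real.exp_sub, Real.exp_log (by norm_num), sub_eq_add_neg, Real.exp_add]; ring
  rw [this, Real.exp_le_exp]
  linarith

lemma Ln_lower (hρm : Measurable ρ) (h0 : ∀ z, 0 ≤ ρ z) {n : ℕ} (hn : 0 < n) (x : ℕ → S)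
    {t D : ℝ} (ht : 0 ≤ t) :
    ENNReal.ofReal ((∑ k ∈ Finset.range n, g ρ Q t (x k)) / n - t * D) ≤ LnIID ρ Q D n x := by
  have hn' : (0:ℝ) < n := by exact_mod_cast hn
  refine Ln_ge hn ((qn_chernoff hρm h0 hn x ht D).trans (le_of_eq ?_))
  congr 1
  field_simp
  ring

lemma sig_ge (h0 : ∀ z, 0 ≤ ρ z) (n : ℕ) (x : ℕ → S) :
    ∀ᵐ y ∂(Measure.pi fun _ : Fin n => Q), ∀ k : Fin n, rhoQ ρ Q (x k) ≤ ρ (x k, y k) := by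
  rw [ae_all_iff]
  intro k
  exact (Measure.tendsto_eval_ae_ae (μ := fun _ : Fin n => Q) (i := k)).eventually
    (ess_le (Q := Q) (r := fun y => ρ (x k, y)) fun _ => h0 _)

lemma Ln_top (h0 : ∀ z, 0 ≤ ρ z) {n : ℕ} (hn : 0 < n) (x : ℕ → S) {D : ℝ}
    (h : n * D < ∑ k ∈ Finset.range n, rhoQ ρ Q (x k)) : LnIID ρ Q D n x = ⊤ := by
  have hz : (Measure.pi fun _ : Fin n => Q) {y | rhoFin ρ n (fun k => x k) y ≤ D} = 0 := by
    have : ∀ᵐ y ∂(Measure.pi fun _ : Fin n => Q), ¬ rhoFin ρ n (fun k => x k) y ≤ D := by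
      filter_upwards [sig_ge (Q := Q) h0 n x] with y hy
      rw [ball_iff hn, not_le]
      refine h.trans_le ?_
      rw [Finset.sum_range]
      exact Finset.sum_le_sum fun k _ => hy k
    rw [ae_iff] at this
    simpa using this
  unfold LnIID negLog
  rw [if_pos hz, ENNReal.mul_top (by simp)]

lemma q_eq_exp {x : S} (hk : kx ρ Q x ≠ ⊤) :
    Q.real {y | ρ (x, y) = rhoQ ρ Q x} = Real.exp (-(kx ρ Q x).toReal) := by
  unfold kx negLog at *
  split_ifs at * with hq
  · simp at hk
  · have h1 : 0 < Q.real {y | ρ (x, y) = rhoQ ρ Q x} := ENNReal.toReal_pos hq (measure_ne_top _ _)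
    have h2 : Q.real {y | ρ (x, y) = rhoQ ρ Q x} ≤ 1 := measureReal_le_one
    rw [← Measure.real, ENNReal.toReal_ofReal, neg_neg, Real.exp_log h1]
    have := Real.log_nonpos h1.le h2
    linarith

lemma core_eq {n : ℕ} (x : ℕ → S) (hk : ∀ k, kx ρ Q (x k) ≠ ⊤) :
    (Measure.pi fun _ : Fin n => Q).real {y | ∀ k : Fin n, ρ (x k, y k) = rhoQ ρ Q (x k)}
      = Real.exp (-∑ k ∈ Finset.range n, (kx ρ Q (x k)).toReal) := by
  have e : {y : Fin n → T | ∀ k : Fin n, ρ (x k, y k) = rhoQ ρ Q (x k)}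
      = Set.pi univ fun k : Fin n => {y | ρ (x k, y) = rhoQ ρ Q (x k)} := by
    ext y; simp
  rw [e, Measure.real, Measure.pi_pi, ENNReal.toReal_prod, ← Finset.sum_neg_distrib, Real.exp_sum,
    Finset.prod_range]
  exact Finset.prod_congr rfl fun k _ => q_eq_exp (hk k)

lemma Ln_core {n : ℕ} (hn : 0 < n) (x : ℕ → S) {D : ℝ} (hk : ∀ k, kx ρ Q (x k) ≠ ⊤)
    (h : ∑ k ∈ Finset.range n, rhoQ ρ Q (x k) ≤ n * D) :
    LnIID ρ Q D n x ≤ ENNReal.ofReal ((∑ k ∈ Finset.range n, (kx ρ Q (x k)).toReal) / n) := by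
  have hn' : (n:ℝ) ≠ 0 := by exact_mod_cast hn.ne'
  refine Ln_le hn ?_
  rw [mul_div_cancel₀ _ hn', ← core_eq x hk]
  refine measureReal_mono (fun y hy => ?_) (measure_ne_top _ _)
  rw [mem_ofPred_eq, ball_iff hn]
  refine le_trans (le_of_eq ?_) h
  rw [Finset.sum_range, sig]
  exact Finset.sum_congr rfl fun k _ => hy k

lemma Ln_core_eq (h0 : ∀ z, 0 ≤ ρ z) {n : ℕ} (hn : 0 < n) (x : ℕ → S) {D : ℝ}
    (hk : ∀ k, kx ρ Q (x k) ≠ ⊤) (h : ∑ k ∈ Finset.range n, rhoQ ρ Q (x k) = n * D) :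
    LnIID ρ Q D n x = ENNReal.ofReal ((∑ k ∈ Finset.range n, (kx ρ Q (x k)).toReal) / n) := by
  have hn' : (n:ℝ) ≠ 0 := by exact_mod_cast hn.ne'
  refine le_antisymm (Ln_core hn x hk h.le) (Ln_ge hn ?_)
  rw [mul_div_cancel₀ _ hn', ← core_eq x hk]
  refine ENNReal.toReal_mono (measure_ne_top _ _) (measure_mono_ae ?_)
  filter_upwards [sig_ge (Q := Q) h0 n x] with y hy hyb
  have hyb : rhoFin ρ n (fun k => x k) y ≤ D := hyb
  rw [ball_iff hn, ← h, Finset.sum_range] at hyb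
  have := (Finset.sum_eq_sum_iff_of_le (s := Finset.univ) (fun k _ => hy k)).1
    (le_antisymm (Finset.sum_le_sum fun k _ => hy k) hyb)
  exact fun k => (this k (Finset.mem_univ k)).symm

end Ln
end GAEP

namespace GAEP

section Final
variable {S T : Type*} [MeasurableSpace S] [MeasurableSpace T] {P : Measure S} {Q : Measure T}
  [IsProbabilityMeasure P] [IsProbabilityMeasure Q] {ρ : S × T → ℝ}
  {Psrc : Measure (ℕ → S)} [IsProbabilityMeasure Psrc]

lemma shift_iter (k : ℕ) (x : ℕ → S) : (shiftSeq^[k] x) 0 = x k := by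
  have : ∀ (k j : ℕ) (x : ℕ → S), (shiftSeq^[k] x) j = x (j + k) := by
    intro k
    induction k with
    | zero => intro j x; rfl
    | succ k ih => 
      intro j x
      rw [Function.iterate_succ_apply, ih]
      simp only [shiftSeq]
      congr 1
  simpa using this k 0 x

lemma bs_shift (f : S → ℝ) (n : ℕ) (x : ℕ → S) :
    bs shiftSeq (fun x : ℕ → S => f (x 0)) n x = ∑ k ∈ Finset.range n, f (x k) := by
  unfold bs
  exact Finset.sum_congr rfl fun k _ => congrArg f (shift_iter k x)

lemma mp0 (hP1 : Psrc.map (fun x => x 0) = P) :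
    MeasurePreserving (fun x : ℕ → S => x 0) Psrc P := ⟨measurable_pi_apply 0, hP1⟩

lemma ae_seq (hE : Ergodic shiftSeq Psrc) (hP1 : Psrc.map (fun x => x 0) = P) {p : S → Prop}
    (hp : ∀ᵐ s ∂P, p s) : ∀ᵐ x ∂Psrc, ∀ k, p (x k) := by
  rw [ae_all_iff]
  intro k
  have h1 : ∀ᵐ x ∂Psrc, p (x 0) := (mp0 hP1).quasiMeasurePreserving.ae hp
  have h2 := (hE.toMeasurePreserving.iterate k).quasiMeasurePreserving.ae h1
  filter_upwards [h2] with x hx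
  rwa [shift_iter] at hx

lemma slln (hE : Ergodic shiftSeq Psrc) (hP1 : Psrc.map (fun x => x 0) = P) {f : S → ℝ}
    (hm : Measurable f) (hf : Integrable f P) :
    ∀ᵐ x ∂Psrc, Tendsto (fun n : ℕ => (∑ k ∈ Finset.range n, f (x k)) / n) atTop
      (𝓝 (∫ s, f s ∂P)) := by
  have h := birkhoff hE (f := fun x : ℕ → S => f (x 0)) (hm.comp (measurable_pi_apply 0))
    ((mp0 hP1).integrable_comp_of_integrable hf)
  have e : ∫ x, f (x 0) ∂Psrc = ∫ s, f s ∂P := by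
    rw [← hP1]
    exact (integral_map (measurable_pi_apply 0).aemeasurable hm.aestronglyMeasurable).symm
  rw [e] at h
  simpa only [bs_shift] using h

lemma slln_top (hE : Ergodic shiftSeq Psrc) (hP1 : Psrc.map (fun x => x 0) = P) {f : S → ℝ}
    (hm : Measurable f) (h0 : ∀ s, 0 ≤ f s) (hf : ¬ Integrable f P) :
    ∀ᵐ x ∂Psrc, Tendsto (fun n : ℕ => (∑ k ∈ Finset.range n, f (x k)) / n) atTop atTop := by
  have h := birkhoff_top hE (f := fun x : ℕ → S => f (x 0)) (hm.comp (measurable_pi_apply 0))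
    (fun x => h0 _) (by
      rw [← lintegral_map (f := fun s => ENNReal.ofReal (f s)) (g := fun x : ℕ → S => x 0)
        hm.ennreal_ofReal (measurable_pi_apply 0), hP1]
      by_contra h
      exact hf ⟨hm.aestronglyMeasurable, by
        rw [hasFiniteIntegral_iff_ofReal (.of_forall h0)]; exact lt_top_iff_ne_top.2 h⟩)
  simpa only [bs_shift] using h

/-- `L_n → ∞` when the Chernoff exponents are unbounded. -/
lemma lim_top (hρm : Measurable ρ) (h0 : ∀ z, 0 ≤ ρ z) (hE : Ergodic shiftSeq Psrc)
    (hP1 : Psrc.map (fun x => x 0) = P) (hG : Integrable (g ρ Q 1) P) {D : ℝ}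
    (h : ∀ m : ℕ, ∃ t : ℝ, 0 ≤ t ∧ (m:ℝ) < Gam ρ P Q t - t * D) :
    ∀ᵐ x ∂Psrc, Tendsto (fun n => LnIID ρ Q D n x) atTop (𝓝 ⊤) := by
  choose t ht1 ht2 using h
  have : ∀ᵐ x ∂Psrc, ∀ m, Tendsto (fun n : ℕ => (∑ k ∈ Finset.range n, g ρ Q (t m) (x k)) / n)
      atTop (𝓝 (Gam ρ P Q (t m))) := by
    rw [ae_all_iff]
    exact fun m => slln hE hP1 (g_meas hρm _) (g_int hρm h0 hG (ht1 m))
  filter_upwards [this] with x hx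
  rw [ENNReal.tendsto_nhds_top_iff_nat]
  intro m
  have h1 := (hx m).sub_const (t m * D)
  filter_upwards [h1.eventually (lt_mem_nhds (ht2 m)), eventually_gt_atTop 0] with n h2 hn
  refine lt_of_lt_of_le ?_ (Ln_lower hρm h0 hn x (ht1 m))
  rw [← ENNReal.ofReal_natCast]
  exact (ENNReal.ofReal_lt_ofReal_iff_of_nonneg (by positivity)).2 h2

lemma lim_notG (hρm : Measurable ρ) (h0 : ∀ z, 0 ≤ ρ z) (hE : Ergodic shiftSeq Psrc)
    (hP1 : Psrc.map (fun x => x 0) = P) (hG : ¬ Integrable (g ρ Q 1) P) (D : ℝ) :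
    ∀ᵐ x ∂Psrc, Tendsto (fun n => LnIID ρ Q D n x) atTop (𝓝 ⊤) := by
  filter_upwards [slln_top hE hP1 (g_meas hρm 1) (fun s => g_nonneg hρm h0 zero_le_one s) hG]
    with x hx
  rw [ENNReal.tendsto_nhds_top_iff_nat]
  intro m
  filter_upwards [hx.eventually_gt_atTop (m + 1 * D), eventually_gt_atTop 0] with n h2 hn
  refine lt_of_lt_of_le ?_ (Ln_lower hρm h0 hn x zero_le_one)
  rw [← ENNReal.ofReal_natCast]
  exact (ENNReal.ofReal_lt_ofReal_iff_of_nonneg (by positivity)).2 (by linarith)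

lemma lim_lt (hρm : Measurable ρ) (h0 : ∀ z, 0 ≤ ρ z) (hE : Ergodic shiftSeq Psrc)
    (hP1 : Psrc.map (fun x => x 0) = P) (hG : Integrable (g ρ Q 1) P) {D : ℝ}
    (hD : D < ∫ x, rhoQ ρ Q x ∂P) :
    ∀ᵐ x ∂Psrc, Tendsto (fun n => LnIID ρ Q D n x) atTop (𝓝 ⊤) := by
  refine lim_top hρm h0 hE hP1 hG fun m => ?_
  have hd : 0 < (∫ x, rhoQ ρ Q x ∂P) - D := sub_pos.2 hD
  refine ⟨(m + 1) / ((∫ x, rhoQ ρ Q x ∂P) - D), by positivity, ?_⟩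
  have h1 := Gam_ge hρm h0 hG (t := (m + 1) / ((∫ x, rhoQ ρ Q x ∂P) - D)) (by positivity)
  have h2 : (m + 1 : ℝ) / ((∫ x, rhoQ ρ Q x ∂P) - D) * ((∫ x, rhoQ ρ Q x ∂P) - D) = m + 1 := by
    field_simp
  linarith

lemma lim_K (hρm : Measurable ρ) (h0 : ∀ z, 0 ≤ ρ z) (hE : Ergodic shiftSeq Psrc)
    (hP1 : Psrc.map (fun x => x 0) = P) (hG : Integrable (g ρ Q 1) P)
    (hK : ∫⁻ x, kx ρ Q x ∂P = ⊤) :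
    ∀ᵐ x ∂Psrc, Tendsto (fun n => LnIID ρ Q (∫ x, rhoQ ρ Q x ∂P) n x) atTop (𝓝 ⊤) := by
  refine lim_top hρm h0 hE hP1 hG fun m => ?_
  have h1 := kx_tendsto hρm h0 hG
  rw [hK, ENNReal.tendsto_nhds_top_iff_nat] at h1
  obtain ⟨n, hn⟩ := (h1 m).exists
  refine ⟨n, by positivity, ?_⟩
  rw [← ENNReal.ofReal_natCast] at hn
  exact (ENNReal.ofReal_lt_ofReal_iff_of_nonneg (by positivity)).1 hn

lemma lim_gt (hρm : Measurable ρ) (h0 : ∀ z, 0 ≤ ρ z) (hE : Ergodic shiftSeq Psrc)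
    (hP1 : Psrc.map (fun x => x 0) = P) (hG : Integrable (g ρ Q 1) P) {D : ℝ}
    (hD : (∫ x, rhoQ ρ Q x ∂P) < D) :
    ∃ l : ℝ≥0∞, ∀ᵐ x ∂Psrc, Tendsto (fun n => LnIID ρ Q D n x) atTop (𝓝 l) := by
  obtain ⟨l, hl, ⟨t0, ht0, hlt⟩, hv⟩ := variational (Gam_cont hρm h0 hG) Gam_zero
    (Gam_mono hρm h0 hG) (Gam_ratio hρm h0 hG) (Gam_diff hρm h0 hG) hD (Gam_div_tendsto hρm h0 hG)
  refine ⟨ENNReal.ofReal l, ?_⟩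
  have hS : ∀ t, 0 ≤ t → ∀ᵐ x ∂Psrc, Tendsto (fun n : ℕ =>
      (∑ k ∈ Finset.range n, g ρ Q t (x k)) / n) atTop (𝓝 (Gam ρ P Q t)) :=
    fun t ht => slln hE hP1 (g_meas hρm _) (g_int hρm h0 hG ht)
  have hup : ∀ᵐ x ∂Psrc, ∀ j : ℕ, ∀ᶠ n in atTop,
      LnIID ρ Q D n x ≤ ENNReal.ofReal (l + 1 / ((j:ℝ) + 1)) := by
    rw [ae_all_iff]
    intro j
    obtain ⟨t, a, s, s', ht, hs, hst, hs', c1, c2, c3⟩ := hv (1 / ((j:ℝ) + 1)) (by positivity)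
    filter_upwards [hS t ht.le, hS (t - s) (by linarith), hS (t + s') (by linarith)] with x l1 l2 l3
    exact Ln_upper hρm h0 x ht.le hs.le hst hs'.le c1 c2 c3 l1 l2 l3
  filter_upwards [hup, hS t0 ht0] with x hx hx0
  rw [tendsto_order]
  constructor
  · intro b hb
    have h1 := ENNReal.tendsto_ofReal (hx0.sub_const (t0 * D))
    rw [hlt] at h1
    filter_upwards [h1.eventually (lt_mem_nhds hb), eventually_gt_atTop 0] with n h2 hn
    exact lt_of_lt_of_le h2 (Ln_lower hρm h0 hn x ht0)
  · intro b hb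
    have h1 : Tendsto (fun j : ℕ => ENNReal.ofReal (l + 1 / ((j:ℝ) + 1))) atTop
        (𝓝 (ENNReal.ofReal (l + 0))) :=
      ENNReal.tendsto_ofReal (tendsto_const_nhds.add tendsto_one_div_add_atTop_nhds_zero_nat)
    rw [add_zero] at h1
    obtain ⟨j, hj⟩ := (h1.eventually (gt_mem_nhds hb)).exists
    filter_upwards [hx j] with n hn
    exact lt_of_le_of_lt hn hj

lemma kx_ae (hρm : Measurable ρ) (h0 : ∀ z, 0 ≤ ρ z) (hE : Ergodic shiftSeq Psrc)
    (hP1 : Psrc.map (fun x => x 0) = P) (hK : ∫⁻ x, kx ρ Q x ∂P ≠ ⊤) :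
    ∀ᵐ x ∂Psrc, (∀ k, kx ρ Q (x k) ≠ ⊤) ∧ Tendsto (fun n : ℕ =>
      (∑ k ∈ Finset.range n, (kx ρ Q (x k)).toReal) / n) atTop
      (𝓝 (∫ x, (kx ρ Q x).toReal ∂P)) := by
  have h1 : ∀ᵐ s ∂P, kx ρ Q s ≠ ⊤ := by
    filter_upwards [ae_lt_top (kx_meas hρm h0) hK] with s hs using hs.ne
  filter_upwards [ae_seq hE hP1 h1, slln hE hP1 (kx_meas hρm h0).ennreal_toReal
    (integrable_toReal_of_lintegral_ne_top (kx_meas hρm h0).aemeasurable hK)] with x h2 h3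
  exact ⟨h2, h3⟩

lemma lim_const (hρm : Measurable ρ) (h0 : ∀ z, 0 ≤ ρ z) (hE : Ergodic shiftSeq Psrc)
    (hP1 : Psrc.map (fun x => x 0) = P) (hK : ∫⁻ x, kx ρ Q x ∂P ≠ ⊤) {c : ℝ}
    (hc : ∀ᵐ s ∂P, rhoQ ρ Q s = c) :
    ∃ l : ℝ≥0∞, ∀ᵐ x ∂Psrc, Tendsto (fun n => LnIID ρ Q (∫ x, rhoQ ρ Q x ∂P) n x) atTop (𝓝 l) := by
  have e : ∫ x, rhoQ ρ Q x ∂P = c := by rw [integral_congr_ae hc]; simp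
  rw [e]
  refine ⟨ENNReal.ofReal (∫ x, (kx ρ Q x).toReal ∂P), ?_⟩
  filter_upwards [kx_ae hρm h0 hE hP1 hK, ae_seq hE hP1 hc] with x hx hxc
  refine (ENNReal.tendsto_ofReal hx.2).congr' ?_
  filter_upwards [eventually_gt_atTop 0] with n hn
  refine (Ln_core_eq h0 hn x hx.1 ?_).symm
  simp [hxc]

lemma no_lim (hρm : Measurable ρ) (h0 : ∀ z, 0 ≤ ρ z) (hE : Ergodic shiftSeq Psrc)
    (hP1 : Psrc.map (fun x => x 0) = P) (hG : Integrable (g ρ Q 1) P)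
    (hK : ∫⁻ x, kx ρ Q x ∂P ≠ ⊤) (hc : ¬ ∃ c : ℝ, ∀ᵐ s ∂P, rhoQ ρ Q s = c) :
    ∃ᶠ x in ae Psrc, ¬ ∃ l : ℝ≥0∞,
      Tendsto (fun n => LnIID ρ Q (∫ x, rhoQ ρ Q x ∂P) n x) atTop (𝓝 l) := by
  set d := ∫ x, rhoQ ρ Q x ∂P with hd
  set f : S → ℝ := fun s => rhoQ ρ Q s - d with hf
  have hfm : Measurable f := (rhoQ_meas hρm h0).sub_const _
  have hri := rhoQ_int hρm h0 hG
  have hfi : Integrable f P := hri.sub (integrable_const _)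
  have hosc := oscillation hE (f := fun x : ℕ → S => f (x 0)) (hfm.comp (measurable_pi_apply 0))
    ((mp0 hP1).integrable_comp_of_integrable hfi)
    (by
      have : ∫ x, f (x 0) ∂Psrc = ∫ s, f s ∂P := by
        rw [← hP1]
        exact (integral_map (measurable_pi_apply 0).aemeasurable hfm.aestronglyMeasurable).symm
      rw [this, hf, integral_sub hri (integrable_const _)]
      simp [hd])
    (by
      intro h
      refine hc ⟨d, ?_⟩
      have : ∀ᵐ s ∂P, f s = 0 := by
        rw [← hP1]
        exact (ae_map_iff (measurable_pi_apply 0).aemeasurable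
          (measurableSet_eq_fun hfm measurable_const)).2 h
      filter_upwards [this] with s hs
      simp only [hf] at hs
      linarith)
  refine (hosc.and_eventually (kx_ae hρm h0 hE hP1 hK)).mono ?_
  rintro x ⟨⟨hp, hn⟩, hk, hlim⟩ ⟨l, hl⟩
  simp only [bs_shift] at hp hn
  have hsum : ∀ n : ℕ, ∑ k ∈ Finset.range n, f (x k)
      = (∑ k ∈ Finset.range n, rhoQ ρ Q (x k)) - n * d := by
    intro n; simp [hf, Finset.sum_sub_distrib]
  have htop : l = ⊤ := by
    by_contra h
    have h1 := hl.eventually (gt_mem_nhds (lt_top_iff_ne_top.2 h))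
    obtain ⟨n, hn1, hn2, hn3⟩ := (hp.and_eventually (h1.and (eventually_gt_atTop 0))).exists
    rw [hsum] at hn1
    rw [Ln_top h0 hn3 x (by linarith)] at hn2
    exact lt_irrefl _ hn2
  rw [htop] at hl
  have h1 := hl.eventually (lt_mem_nhds (ENNReal.ofReal_lt_top
    (r := (∫ x, (kx ρ Q x).toReal ∂P) + 1)))
  have h2 := hlim.eventually (gt_mem_nhds (lt_add_one _))
  obtain ⟨n, hn1, hn2, hn3, hn4⟩ :=
    (hn.and_eventually (h1.and (h2.and (eventually_gt_atTop 0)))).exists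
  rw [hsum] at hn1
  have h3 := Ln_core hn4 x (D := d) hk (by linarith)
  exact absurd (hn2.trans_le (h3.trans (ENNReal.ofReal_le_ofReal hn3.le))) (lt_irrefl _)

lemma main (hρm : Measurable ρ) (h0 : ∀ z, 0 ≤ ρ z) (hE : Ergodic shiftSeq Psrc)
    (hP1 : Psrc.map (fun x => x 0) = P) (D : ℝ) :
    0 < Psrc {x | ¬ ∃ l : ℝ≥0∞, Tendsto (fun n => LnIID ρ Q D n x) atTop (𝓝 l)} ↔
      (0 < D ∧ {D' : ℝ | Rrate ρ P Q D' ≠ ⊤}.Nonempty ∧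
        D = sInf {D' : ℝ | Rrate ρ P Q D' ≠ ⊤} ∧ Rrate ρ P Q D ≠ ⊤ ∧
        ¬ ∃ c : ℝ, ∀ᵐ s ∂P, rhoQ ρ Q s = c) := by
  rw [pos_iff_ne_zero, ← frequently_ae_iff]
  constructor
  · intro h
    have hno : ∀ l : ℝ≥0∞, ¬ ∀ᵐ x ∂Psrc, Tendsto (fun n => LnIID ρ Q D n x) atTop (𝓝 l) := by
      intro l hl
      obtain ⟨x, hx1, hx2⟩ := (h.and_eventually hl).exists
      exact hx1 ⟨l, hx2⟩
    have hG : Integrable (g ρ Q 1) P := by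
      by_contra hG
      exact hno _ (lim_notG hρm h0 hE hP1 hG D)
    have hD : D = ∫ x, rhoQ ρ Q x ∂P := by
      rcases lt_trichotomy D (∫ x, rhoQ ρ Q x ∂P) with h1 | h1 | h1
      · exact absurd (lim_lt hρm h0 hE hP1 hG h1) (hno _)
      · exact h1
      · obtain ⟨l, hl⟩ := lim_gt hρm h0 hE hP1 hG h1
        exact absurd hl (hno l)
    have hK : ∫⁻ x, kx ρ Q x ∂P ≠ ⊤ := by
      intro hK
      have := lim_K hρm h0 hE hP1 hG hK
      rw [← hD] at this
      exact hno _ this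
    have hc : ¬ ∃ c : ℝ, ∀ᵐ s ∂P, rhoQ ρ Q s = c := by
      rintro ⟨c, hc⟩
      obtain ⟨l, hl⟩ := lim_const hρm h0 hE hP1 hK hc
      rw [← hD] at hl
      exact hno l hl
    obtain ⟨r1, r2⟩ := rate_set hρm h0 hG
    refine ⟨?_, r1, by rw [r2, hD], by rw [hD]; exact rate_suff' hρm h0 hG hK, hc⟩
    have hd0 : 0 ≤ ∫ x, rhoQ ρ Q x ∂P := integral_nonneg fun x => rhoQ_nonneg hρm h0 x
    rw [hD]
    refine lt_of_le_of_ne hd0 fun he => hc ⟨0, ?_⟩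
    exact (integral_eq_zero_iff_of_nonneg (fun x => rhoQ_nonneg hρm h0 x)
      (rhoQ_int hρm h0 hG)).1 he.symm
  · rintro ⟨hD0, hne, hD, hR, hc⟩
    obtain ⟨hG, _, hK⟩ := rate_nec hρm h0 hR
    obtain ⟨r1, r2⟩ := rate_set hρm h0 hG
    rw [r2] at hD
    rw [hD]
    exact no_lim hρm h0 hE hP1 hG (hK hD) hc

end Final
end GAEP

/-- `lim_n L_n(X_1^n,Q^n,D)` fails to exist with positive
probability if and only if `0 < D = D_min(P,Q) < ∞`, `R(P,Q,D) < ∞` and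
`ρ_Q(X_1)` is not almost surely constant. -/
theorem stmt10 {S T : Type*} [MeasurableSpace S] [StandardBorelSpace S]
    [MeasurableSpace T] [StandardBorelSpace T]
    (ρ : S × T → ℝ) (hρm : Measurable ρ) (hρ0 : ∀ z, 0 ≤ ρ z)
    (P : Measure S) (Q : Measure T) [IsProbabilityMeasure P] [IsProbabilityMeasure Q]
    (Psrc : Measure (ℕ → S)) [IsProbabilityMeasure Psrc]
    (hErg : Ergodic shiftSeq Psrc)
    (hP1 : Psrc.map (fun x => x 0) = P) (D : ℝ) :
    0 < Psrc {x | ¬ ∃ l : ℝ≥0∞, Tendsto (fun n => LnIID ρ Q D n x) atTop (𝓝 l)} ↔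
      (0 < D ∧ {D' : ℝ | Rrate ρ P Q D' ≠ ⊤}.Nonempty ∧
        D = sInf {D' : ℝ | Rrate ρ P Q D' ≠ ⊤} ∧ Rrate ρ P Q D ≠ ⊤ ∧
        ¬ ∃ c : ℝ, ∀ᵐ s ∂P, rhoQ ρ Q s = c) := by
  exact GAEP.main hρm hρ0 hErg hP1 D

end
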